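/- arXiv:1310.4896 — 14 statements merged into one kernel-verified Lean document; each statement's English description precedes it below -/
import Mathlib

section
/- Let h : ℝ → ℝ be continuous and strictly monotone (hence a bijection onto its range, with inverse h⁻¹ defined on the range), and assume h(x) > 0 for all x > 0 and h(x) ≤ 0 for all x ≤ 0. Let EC : (0,1] → ℝ be continuous, taking values in the range of h, with EC(p) > 0 for all p ∈ (0,1), and suppose that h⁻¹(EC(p·q)) = h⁻¹(EC(p)) + h⁻¹(EC(q)) for all p, q ∈ (0,1]. Then there exists τ < 0 such that EC(p) = h(τ·log₂ p) for all p ∈ (0,1]. -/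
open Set

theorem additive_pos_linear (g : ℝ → ℝ)
    (hadd : ∀ x y : ℝ, 0 ≤ x → 0 ≤ y → g (x + y) = g x + g y)
    (hp : ∀ x : ℝ, 0 < x → 0 < g x) (x : ℝ) (hx : 0 ≤ x) : g x = g 1 * x := by
  have h0 : g 0 = 0 := by
    have := hadd 0 0 le_rfl le_rfl
    simp at this
    exact this
  have hmono : ∀ a b : ℝ, 0 ≤ a → a ≤ b → g a ≤ g b := by
    intro a b ha hab
    have h1 := hadd a (b - a) ha (by linarith)
    rw [add_sub_cancel] at h1
    rcases hab.eq_or_lt with h2 | h2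
    · rw [h2]
    · have := hp (b - a) (by linarith)
      linarith
  have hmul : ∀ (n : ℕ) (y : ℝ), 0 ≤ y → g (n * y) = n * g y := by
    intro n y hy
    induction n with
    | zero => simp [h0]
    | succ k ih =>
      have h1 := hadd (k * y) y (by positivity) hy
      push_cast
      rw [add_mul, one_mul, h1, ih]
      ring
  have hc := hp 1 one_pos
  have key : ∀ n : ℕ, |(n : ℝ) * (g x - g 1 * x)| ≤ g 1 := by
    intro n
    have hnx : 0 ≤ (n : ℝ) * x := by positivity
    have h1 := Nat.floor_le hnx
    have h2 := (Nat.lt_floor_add_one ((n : ℝ) * x)).le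
    generalize ⌊(n : ℝ) * x⌋₊ = m at h1 h2
    have h3 := hmono _ _ (by positivity) h1
    have h4 := hmono _ _ hnx h2
    have h5 := hmul m 1 zero_le_one
    have h6 := hmul (m + 1) 1 zero_le_one
    push_cast at h6
    rw [mul_one] at h5 h6
    rw [hmul n x hx] at h3 h4
    rw [abs_le]
    constructor <;> nlinarith
  by_contra hne
  have hd : 0 < |g x - g 1 * x| := abs_pos.mpr (sub_ne_zero.mpr hne)
  obtain ⟨n, hn⟩ := exists_nat_gt (g 1 / |g x - g 1 * x|)
  rw [div_lt_iff₀ hd] at hn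
  have := key n
  rw [abs_mul, Nat.abs_cast] at this
  linarith

/-- Characterization of the composable Inforcer content
(first part of Theorem 1): `EC p = h (τ * log₂ p)` for some `τ < 0`. -/
theorem inforcer_content_characterization (h hinv EC : ℝ → ℝ)
    (hc : Continuous h) (hm : StrictMono h ∨ StrictAnti h)
    (hpos : ∀ x : ℝ, 0 < x → 0 < h x) (hneg : ∀ x : ℝ, x ≤ 0 → h x ≤ 0)
    (hli : ∀ x : ℝ, hinv (h x) = x)
    (hECc : ContinuousOn EC (Ioc (0:ℝ) 1))
    (hECrange : ∀ p ∈ Ioc (0:ℝ) 1, EC p ∈ range h)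
    (hECpos : ∀ p ∈ Ioo (0:ℝ) 1, 0 < EC p)
    (hcomp : ∀ p ∈ Ioc (0:ℝ) 1, ∀ q ∈ Ioc (0:ℝ) 1,
      hinv (EC (p * q)) = hinv (EC p) + hinv (EC q)) :
    ∃ τ : ℝ, τ < 0 ∧ ∀ p ∈ Ioc (0:ℝ) 1, EC p = h (τ * Real.logb 2 p) := by
  have hh : ∀ p ∈ Ioc (0:ℝ) 1, h (hinv (EC p)) = EC p := by
    intro p hp
    obtain ⟨x, hx⟩ := hECrange p hp
    rw [← hx, hli]
  have hmem : ∀ x : ℝ, 0 ≤ x → (2:ℝ) ^ (-x) ∈ Ioc (0:ℝ) 1 := fun x hx =>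
    ⟨by positivity, Real.rpow_le_one_of_one_le_of_nonpos (by norm_num) (by linarith)⟩
  have hpg : ∀ x : ℝ, 0 < x → 0 < hinv (EC ((2:ℝ) ^ (-x))) := by
    intro x hx
    by_contra hle
    have h1 := hneg _ (not_lt.mp hle)
    rw [hh _ (hmem x hx.le)] at h1
    have h2 := hECpos ((2:ℝ) ^ (-x))
      ⟨by positivity, Real.rpow_lt_one_of_one_lt_of_neg (by norm_num) (by linarith)⟩
    linarith
  have lin := additive_pos_linear (fun x => hinv (EC ((2:ℝ) ^ (-x))))
    (by
      intro x y hx hy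
      rw [neg_add, Real.rpow_add (by norm_num)]
      exact hcomp _ (hmem x hx) _ (hmem y hy)) hpg
  refine ⟨-hinv (EC ((2:ℝ) ^ (-(1:ℝ)))), by linarith [hpg 1 one_pos], ?_⟩
  intro p hp
  have hl : 0 ≤ -Real.logb 2 p := by
    have := Real.logb_nonpos (b := 2) (by norm_num) hp.1.le hp.2
    linarith
  have h1 := lin _ hl
  simp only [neg_neg] at h1
  rw [Real.rpow_logb (by norm_num) (by norm_num) hp.1] at h1
  rw [← hh p hp, h1]
  congr 1
  ring
end

section
/- Fix τ < 0 and a continuous strictly monotone function g : [0,∞) → ℝ. For each n ≥ 1, each U = (u_1,…,u_n) ∈ Δ_n and each P = (p_1,…,p_n) ∈ Δ_n⁺, define M(U; P) = g⁻¹( Σ_{k=1}^n u_k · g(τ·log₂ p_k) ). Suppose M is additive over direct products, i.e. M(U⋆V; P⋆Q) = M(U; P) + M(V; Q) for all n, m ≥ 1, U ∈ Δ_n, V ∈ Δ_m, P ∈ Δ_n⁺, Q ∈ Δ_m⁺. Then exactly one of the following holds: either M(U; P) = Σ_{k=1}^n u_k · τ·log₂ p_k for all n, U, P, or there exists λ ≠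 0 such that M(U; P) = (1/λ)·log₂( Σ_{k=1}^n u_k · p_k^{τλ} ) for all n, U, P. -/
open Set

/-- `p` is a probability distribution on `Fin n`. -/
def IsDist {n : ℕ} (p : Fin n → ℝ) : Prop := (∀ i, 0 ≤ p i) ∧ ∑ i, p i = 1

/-- `p` is a strictly positive probability distribution on `Fin n`. -/
def IsPosDist {n : ℕ} (p : Fin n → ℝ) : Prop := (∀ i, 0 < p i) ∧ ∑ i, p i = 1

/-- The direct product `P ⋆ Q` of two distributions, reindexed over `Fin (n*m)`. -/
noncomputable def prodDist {n m : ℕ} (p : Fin n → ℝ) (q : Fin m → ℝ) :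
    Fin (n * m) → ℝ :=
  fun i => p (finProdFinEquiv.symm i).1 * q (finProdFinEquiv.symm i).2

theorem aux_lin (f : ℝ → ℝ) (hc : ContinuousOn f (Ici 0))
    (ha : ∀ x y, 0 ≤ x → 0 ≤ y → f (x + y) = f x + f y) :
    ∃ c, ∀ x, 0 ≤ x → f x = c * x := by
  have key : ∀ p q, 0 ≤ p → 0 ≤ q → f (max (p - q) 0) - f (max (-(p - q)) 0) = f p - f q := by
    intro p q hp hq
    rcases le_total q p with h | h
    · rw [max_eq_left (by linarith), max_eq_right (by linarith)]
      have h1 := ha (p - q) q (by linarith) hq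
      have h2 := ha 0 0 le_rfl le_rfl
      simp at h1 h2
      linarith
    · rw [max_eq_right (by linarith), max_eq_left (by linarith)]
      have h1 := ha (q - p) p (by linarith) hp
      have h2 := ha 0 0 le_rfl le_rfl
      simp at h1 h2
      simp only [neg_sub]
      linarith
  have rep : ∀ x : ℝ, x = max x 0 - max (-x) 0 := by
    intro x
    rcases le_total 0 x with h | h
    · rw [max_eq_left h, max_eq_right (by linarith)]; ring
    · rw [max_eq_right h, max_eq_left (by linarith)]; ring
  let F : ℝ →+ ℝ := AddMonoidHom.mk' (fun x => f (max x 0) - f (max (-x) 0)) (by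
    intro x y
    have h := key (max x 0 + max y 0) (max (-x) 0 + max (-y) 0) (by positivity) (by positivity)
    have e : max x 0 + max y 0 - (max (-x) 0 + max (-y) 0) = x + y := by
      have := rep x
      have := rep y
      linarith
    rw [e, ha _ _ (le_max_right _ _) (le_max_right _ _),
      ha _ _ (le_max_right _ _) (le_max_right _ _)] at h
    show f (max (x + y) 0) - f (max (-(x + y)) 0) = _
    rw [h]; ring)
  have hF : Continuous F := by
    show Continuous (fun x : ℝ => f (max x 0) - f (max (-x) 0))
    apply Continuous.sub
    · exact hc.comp_continuous (by fun_prop) (fun x => mem_Ici.mpr (le_max_right _ _))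
    · exact hc.comp_continuous (by fun_prop) (fun x => mem_Ici.mpr (le_max_right _ _))
  refine ⟨F 1, fun x hx => ?_⟩
  have h := (F.toRealLinearMap hF).map_smul x 1
  simp only [AddMonoidHom.coe_toRealLinearMap, smul_eq_mul, mul_one] at h
  have h0 := ha 0 0 le_rfl le_rfl
  simp at h0
  have h2 : F x = f x := by
    show f (max x 0) - f (max (-x) 0) = _
    rw [max_eq_left hx, max_eq_right (by linarith), h0, sub_zero]
  rw [← h2, h, mul_comm]

theorem aux_form (h : ℝ → ℝ) (hc : ContinuousOn h (Ici 0)) (hi : InjOn h (Ici 0))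
    (h0 : h 0 = 0)
    (H : ∀ t y, 0 ≤ t → 0 ≤ y → (h (t + y) - h y) * h 1 = (h (1 + y) - h y) * h t) :
    (∃ c, c ≠ 0 ∧ ∀ t, 0 ≤ t → h t = c * t) ∨
    (∃ α c, α ≠ 0 ∧ c ≠ 0 ∧ ∀ t, 0 ≤ t → h t = α * (Real.exp (c * t) - 1)) := by
  have h1 : h 1 ≠ 0 := by
    intro e
    have := hi (show (1:ℝ) ∈ Ici (0:ℝ) by simp) (show (0:ℝ) ∈ Ici (0:ℝ) by simp) (by rw [e, h0])
    norm_num at this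
  obtain ⟨A, hA⟩ : ∃ A : ℝ → ℝ, ∀ y, A y = (h (1 + y) - h y) / h 1 := ⟨_, fun _ => rfl⟩
  have H1 : ∀ t y, 0 ≤ t → 0 ≤ y → h (t + y) = A y * h t + h y := by
    intro t y ht hy
    have := H t y ht hy
    rw [hA]; field_simp; linarith
  obtain ⟨k, hk⟩ : ∃ k, k = (A 1 - 1) / h 1 := ⟨_, rfl⟩
  have HA : ∀ t, 0 ≤ t → A t = 1 + k * h t := by
    intro t ht
    have e1 := H1 t 1 ht zero_le_one
    have e2 := H1 1 t zero_le_one ht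
    rw [add_comm] at e1
    rw [hk]; field_simp; linarith
  have H2 : ∀ t y, 0 ≤ t → 0 ≤ y → h (t + y) = h t + h y + k * h t * h y := by
    intro t y ht hy
    rw [H1 t y ht hy, HA y hy]; ring
  by_cases hk0 : k = 0
  · left
    obtain ⟨c, hcc⟩ := aux_lin h hc (by
      intro x y hx hy
      rw [H2 x y hx hy, hk0]; ring)
    refine ⟨c, ?_, hcc⟩
    rintro rfl
    exact h1 (by rw [hcc 1 zero_le_one]; ring)
  · right
    have mulB : ∀ t y, 0 ≤ t → 0 ≤ y →
        1 + k * h (t + y) = (1 + k * h t) * (1 + k * h y) := by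
      intro t y ht hy
      rw [H2 t y ht hy]; ring
    have ne : ∀ t, 0 ≤ t → 1 + k * h t ≠ 0 := by
      intro t ht e
      have e1 := mulB t 1 ht zero_le_one
      rw [e, zero_mul] at e1
      have e2 : h (t + 1) = h t := by
        have : k * h (t + 1) = k * h t := by linarith
        exact mul_left_cancel₀ hk0 this
      have := hi (show t + 1 ∈ Ici (0:ℝ) by simp; linarith) (show t ∈ Ici (0:ℝ) from ht) e2
      linarith
    have pos : ∀ t, 0 ≤ t → 0 < 1 + k * h t := by
      intro t ht
      have e := mulB (t / 2) (t / 2) (by linarith) (by linarith)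
      rw [add_halves] at e
      rw [e]
      exact mul_self_pos.mpr (ne _ (by linarith))
    obtain ⟨c, hcc⟩ := aux_lin (fun t => Real.log (1 + k * h t))
      (ContinuousOn.log (by fun_prop) (fun t ht => ne t ht)) (by
        intro x y hx hy
        rw [mulB x y hx hy, Real.log_mul (ne x hx) (ne y hy)])
    have fin : ∀ t, 0 ≤ t → h t = 1 / k * (Real.exp (c * t) - 1) := by
      intro t ht
      rw [← hcc t ht, Real.exp_log (pos t ht)]
      field_simp; ring
    refine ⟨1 / k, c, one_div_ne_zero hk0, ?_, fin⟩
    rintro rfl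
    exact h1 (by rw [fin 1 zero_le_one]; simp)

/-- core of Theorem 1: an additive quasi-linear mean of the content
`τ·log₂ p` is either the linear mean or a Rényi-type exponential mean, and exactly one
of the two forms holds. -/
theorem inforcer_measure_dichotomy (τ : ℝ) (hτ : τ < 0) (g ginv : ℝ → ℝ)
    (hgc : ContinuousOn g (Ici (0:ℝ)))
    (hgm : StrictMonoOn g (Ici (0:ℝ)) ∨ StrictAntiOn g (Ici (0:ℝ)))
    (hgi : ∀ x ∈ Ici (0:ℝ), ginv (g x) = x)
    (M : ∀ n : ℕ, (Fin n → ℝ) → (Fin n → ℝ) → ℝ)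
    (hM : ∀ (n : ℕ) (U P : Fin n → ℝ),
      M n U P = ginv (∑ k, U k * g (τ * Real.logb 2 (P k))))
    (hadd : ∀ (n m : ℕ) (U : Fin n → ℝ) (V : Fin m → ℝ) (P : Fin n → ℝ) (Q : Fin m → ℝ),
      IsDist U → IsDist V → IsPosDist P → IsPosDist Q →
      M (n * m) (prodDist U V) (prodDist P Q) = M n U P + M m V Q) :
    Xor'
      (∀ (n : ℕ) (U P : Fin n → ℝ), IsDist U → IsPosDist P →
        M n U P = ∑ k, U k * (τ * Real.logb 2 (P k)))
      (∃ lam : ℝ, lam ≠ 0 ∧ ∀ (n : ℕ) (U P : Fin n → ℝ), IsDist U → IsPosDist P →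
        M n U P = (1 / lam) * Real.logb 2 (∑ k, U k * P k ^ (τ * lam))) := by
  have hx0 : ∀ p : ℝ, 0 < p → p ≤ 1 → 0 ≤ τ * Real.logb 2 p := fun p h0 h1 =>
    mul_nonneg_of_nonpos_of_nonpos hτ.le (Real.logb_nonpos one_lt_two h0.le h1)
  have hple : ∀ (n : ℕ) (P : Fin n → ℝ), IsPosDist P → ∀ k, P k ≤ 1 := by
    intro n P hP k
    rw [← hP.2]
    exact Finset.single_le_sum (f := P) (fun i _ => (hP.1 i).le) (Finset.mem_univ k)
  have hinj : InjOn g (Ici 0) := by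
    rcases hgm with h | h
    · exact h.injOn
    · exact h.injOn
  -- convexity of the image
  have hconv : ∀ a : ℝ, 0 ≤ a → ∀ (n : ℕ) (U x : Fin n → ℝ), IsDist U → (∀ k, a ≤ x k) →
      ∃ w, a ≤ w ∧ g w = ∑ k, U k * g (x k) := by
    intro a ha n U x hU hx
    have hcv : Convex ℝ (g '' Ici a) := by
      have : IsPreconnected (g '' Ici a) :=
        isPreconnected_Ici.image g (hgc.mono (Ici_subset_Ici.mpr ha))
      exact this.ordConnected.convex
    have := hcv.sum_mem (t := Finset.univ) (w := U) (z := fun k => g (x k))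
      (fun i _ => hU.1 i) hU.2 (fun i _ => ⟨x i, hx i, rfl⟩)
    obtain ⟨w, hw, e⟩ := this
    exact ⟨w, hw, by simpa using e⟩
  -- shift
  have shift : ∀ (n : ℕ) (U P : Fin n → ℝ) (q : ℝ), IsDist U → IsPosDist P → 0 < q → q < 1 →
      ginv (∑ k, U k * g (τ * Real.logb 2 (P k) + τ * Real.logb 2 q)) =
        M n U P + τ * Real.logb 2 q := by
    intro n U P q hU hP hq0 hq1
    have h := hadd n 2 U ![1, 0] P ![q, 1 - q] hU ⟨by intro i; fin_cases i <;> simp, by simp⟩ hP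
      ⟨by intro i; fin_cases i <;> simp [hq0, hq1], by simp⟩
    have e2 : M 2 ![1, 0] ![q, 1 - q] = τ * Real.logb 2 q := by
      rw [hM]
      simp only [Fin.sum_univ_two, Matrix.cons_val_zero, Matrix.cons_val_one, one_mul, zero_mul,
        add_zero]
      exact hgi _ (hx0 q hq0 hq1.le)
    rw [e2] at h
    rw [← h, hM]
    congr 1
    rw [← finProdFinEquiv.sum_comp, Fintype.sum_prod_type]
    refine Finset.sum_congr rfl fun k _ => ?_
    simp only [prodDist, Equiv.symm_apply_apply, Fin.sum_univ_two, Matrix.cons_val_zero,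
      Matrix.cons_val_one, mul_one, mul_zero, zero_mul, add_zero]
    rw [Real.logb_mul (hP.1 k).ne' hq0.ne', mul_add]
  obtain ⟨a, ha⟩ : ∃ a, a = -2 * τ := ⟨_, rfl⟩
  have ha0 : 0 < a := by linarith
  have hpow : ∀ x : ℝ, τ * Real.logb 2 ((2:ℝ) ^ (x / τ)) = x := by
    intro x
    rw [Real.logb_rpow (by norm_num) (by norm_num)]
    exact mul_div_cancel₀ x hτ.ne
  have hsmall : ∀ x : ℝ, a ≤ x → (2:ℝ) ^ (x / τ) ≤ 1 / 4 := by
    intro x hx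
    have : x / τ ≤ (-2 : ℝ) := by
      rw [div_le_iff_of_neg hτ]; linarith
    calc (2:ℝ) ^ (x / τ) ≤ (2:ℝ) ^ (-2 : ℝ) := Real.rpow_le_rpow_of_exponent_le (by norm_num) this
      _ = 1 / 4 := by
        rw [Real.rpow_neg (by norm_num)]; norm_num
  -- two-point version
  have two : ∀ (u x1 x2 z y : ℝ), 0 ≤ u → u ≤ 1 → a ≤ x1 → a ≤ x2 → a ≤ z → 0 < y →
      g z = u * g x1 + (1 - u) * g x2 →
      g (z + y) = u * g (x1 + y) + (1 - u) * g (x2 + y) := by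
    intro u x1 x2 z y hu0 hu1 h1 h2 hz hy e
    have s1 := hsmall x1 h1
    have s2 := hsmall x2 h2
    have p1 : (0:ℝ) < (2:ℝ) ^ (x1 / τ) := by positivity
    have p2 : (0:ℝ) < (2:ℝ) ^ (x2 / τ) := by positivity
    have hU : IsDist ![u, 1 - u, 0] :=
      ⟨by intro i; fin_cases i <;> simp [hu0, hu1], by simp [Fin.sum_univ_three]⟩
    have hP : IsPosDist ![(2:ℝ) ^ (x1 / τ), (2:ℝ) ^ (x2 / τ),
        1 - (2:ℝ) ^ (x1 / τ) - (2:ℝ) ^ (x2 / τ)] :=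
      ⟨by
        intro i; fin_cases i
        · exact p1
        · exact p2
        · show 0 < 1 - (2:ℝ) ^ (x1 / τ) - (2:ℝ) ^ (x2 / τ)
          linarith, by simp [Fin.sum_univ_three]⟩
    have h := shift 3 _ _ ((2:ℝ) ^ (y / τ)) hU hP (by positivity)
      (Real.rpow_lt_one_of_one_lt_of_neg (by norm_num) (div_neg_of_pos_of_neg hy hτ))
    rw [hM] at h
    simp only [Fin.sum_univ_three, Matrix.cons_val_zero, Matrix.cons_val_one, Matrix.cons_val,
      zero_mul, add_zero, hpow] at h
    rw [← e, hgi z (by simp; linarith)] at h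
    obtain ⟨w, hw, ew⟩ := hconv a ha0.le 2 ![u, 1 - u] ![x1 + y, x2 + y]
      ⟨by intro i; fin_cases i <;> simp [hu0, hu1], by simp⟩
      (by intro i; fin_cases i <;> simp <;> linarith)
    simp only [Fin.sum_univ_two, Matrix.cons_val_zero, Matrix.cons_val_one] at ew
    rw [← ew, hgi w (by simp; linarith)] at h
    rw [← ew, h]
  have three : ∀ s w y, 0 < s → s < w → 0 < y →
      (g (a + s + y) - g (a + y)) * (g (a + w) - g a) =
        (g (a + w + y) - g (a + y)) * (g (a + s) - g a) := by
    intro s w y hs hw hy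
    have m0 : a ∈ Ici (0:ℝ) := ha0.le
    have m1 : a + s ∈ Ici (0:ℝ) := by simp; linarith
    have m2 : a + w ∈ Ici (0:ℝ) := by simp; linarith
    have hne : g (a + w) - g a ≠ 0 := by
      intro e
      have := hinj m2 m0 (by linarith)
      linarith
    have hu : 0 ≤ (g (a + w) - g (a + s)) / (g (a + w) - g a) ∧
        0 ≤ (g (a + s) - g a) / (g (a + w) - g a) := by
      rcases hgm with h | h
      · have i1 := h m0 m1 (by linarith)
        have i2 := h m1 m2 (by linarith)
        exact ⟨div_nonneg (by linarith) (by linarith), div_nonneg (by linarith) (by linarith)⟩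
      · have i1 := h m0 m1 (by linarith)
        have i2 := h m1 m2 (by linarith)
        exact ⟨div_nonneg_of_nonpos (by linarith) (by linarith),
          div_nonneg_of_nonpos (by linarith) (by linarith)⟩
    have hsum : 1 - (g (a + w) - g (a + s)) / (g (a + w) - g a) =
        (g (a + s) - g a) / (g (a + w) - g a) := by
      field_simp; ring
    have h := two ((g (a + w) - g (a + s)) / (g (a + w) - g a)) a (a + w) (a + s) y hu.1
      (by linarith [hu.2]) le_rfl (by linarith) (by linarith) hy
      (by rw [hsum]; field_simp; ring)
    rw [hsum] at h
    rw [h]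
    field_simp
    ring
  have form := aux_form (fun t => g (a + t) - g a)
    (by
      apply ContinuousOn.sub _ continuousOn_const
      exact hgc.comp (by fun_prop) (fun t ht => by
        have : (0:ℝ) ≤ t := ht
        show 0 ≤ a + t
        linarith))
    (by
      intro s hs t ht e
      have hs : (0:ℝ) ≤ s := hs
      have ht : (0:ℝ) ≤ t := ht
      simp only [sub_left_inj] at e
      have := hinj (show a + s ∈ Ici (0:ℝ) by simp; linarith)
        (show a + t ∈ Ici (0:ℝ) by simp; linarith) e
      linarith)
    (by simp)
    (by
      intro t y ht hy
      simp only [sub_sub_sub_cancel_right, ← add_assoc]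
      rcases hy.eq_or_lt with rfl | hy
      · simp; ring
      rcases ht.eq_or_lt with rfl | ht
      · simp
      rcases lt_trichotomy t 1 with h | rfl | h
      · exact three t 1 y ht h hy
      · rfl
      · have := three 1 t y one_pos h hy
        linarith)
  have hquart : τ * Real.logb 2 ((2:ℝ) ^ (a / τ)) = a := hpow a
  have main : ∀ (n : ℕ) (U P : Fin n → ℝ), IsDist U → IsPosDist P →
      ∃ t, 0 ≤ t ∧ M n U P = t ∧
        g (a + t) - g a = ∑ k, U k * (g (a + τ * Real.logb 2 (P k)) - g a) := by
    intro n U P hU hP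
    have h := shift n U P ((2:ℝ) ^ (a / τ)) hU hP (by positivity)
      (by linarith [hsmall a le_rfl])
    rw [hpow] at h
    have hk : ∀ k, 0 ≤ τ * Real.logb 2 (P k) := fun k => hx0 _ (hP.1 k) (hple n P hP k)
    obtain ⟨w, hw, ew⟩ := hconv a ha0.le n U (fun k => τ * Real.logb 2 (P k) + a) hU
      (fun k => by linarith [hk k])
    rw [← ew, hgi w (by simp; linarith)] at h
    refine ⟨w - a, by linarith, by linarith, ?_⟩
    simp only [mul_sub, Finset.sum_sub_distrib, ← Finset.sum_mul, hU.2, one_mul]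
    rw [add_sub_cancel, ew]
    simp only [add_comm]
  have disj : (∀ (n : ℕ) (U P : Fin n → ℝ), IsDist U → IsPosDist P →
        M n U P = ∑ k, U k * (τ * Real.logb 2 (P k))) ∨
      (∃ lam : ℝ, lam ≠ 0 ∧ ∀ (n : ℕ) (U P : Fin n → ℝ), IsDist U → IsPosDist P →
        M n U P = (1 / lam) * Real.logb 2 (∑ k, U k * P k ^ (τ * lam))) := by
    have l2 : 0 < Real.log 2 := Real.log_pos one_lt_two
    rcases form with ⟨c, hc, hf⟩ | ⟨α, c, hα, hc, hf⟩
    · left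
      intro n U P hU hP
      obtain ⟨t, ht, e, h⟩ := main n U P hU hP
      have hk : ∀ k, 0 ≤ τ * Real.logb 2 (P k) := fun k => hx0 _ (hP.1 k) (hple n P hP k)
      have h' : c * t = c * ∑ k, U k * (τ * Real.logb 2 (P k)) := by
        rw [← hf t ht]
        rw [h, Finset.mul_sum]
        refine Finset.sum_congr rfl fun k _ => ?_
        have := hf _ (hk k)
        rw [this]; ring
      rw [e]
      exact mul_left_cancel₀ hc h'
    · right
      refine ⟨c / Real.log 2, div_ne_zero hc l2.ne', ?_⟩
      intro n U P hU hP
      obtain ⟨t, ht, e, h⟩ := main n U P hU hP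
      have hk : ∀ k, 0 ≤ τ * Real.logb 2 (P k) := fun k => hx0 _ (hP.1 k) (hple n P hP k)
      have h' : α * (Real.exp (c * t) - 1) =
          α * ((∑ k, U k * P k ^ (τ * (c / Real.log 2))) - 1) := by
        rw [← hf t ht]
        rw [h]
        conv_rhs => rw [← hU.2]
        rw [← Finset.sum_sub_distrib, Finset.mul_sum]
        refine Finset.sum_congr rfl fun k _ => ?_
        have := hf _ (hk k)
        rw [this, Real.rpow_def_of_pos (hP.1 k)]
        have e3 : c * (τ * Real.logb 2 (P k)) = Real.log (P k) * (τ * (c / Real.log 2)) := by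
          rw [Real.logb]; field_simp
        rw [e3]; ring
      have h2 := mul_left_cancel₀ hα h'
      have h3 : Real.exp (c * t) = ∑ k, U k * P k ^ (τ * (c / Real.log 2)) := by linarith
      rw [e, ← h3, Real.logb, Real.log_exp]
      field_simp
  have excl : ¬ ((∀ (n : ℕ) (U P : Fin n → ℝ), IsDist U → IsPosDist P →
        M n U P = ∑ k, U k * (τ * Real.logb 2 (P k))) ∧
      (∃ lam : ℝ, lam ≠ 0 ∧ ∀ (n : ℕ) (U P : Fin n → ℝ), IsDist U → IsPosDist P →
        M n U P = (1 / lam) * Real.logb 2 (∑ k, U k * P k ^ (τ * lam)))) := by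
    rintro ⟨h1, lam, hl, h2⟩
    have hU : IsDist ![(1/2 : ℝ), 1/2] :=
      ⟨by intro i; fin_cases i <;> simp, by simp; norm_num⟩
    have hP : IsPosDist ![(1/4 : ℝ), 3/4] :=
      ⟨by intro i; fin_cases i <;> simp, by simp; norm_num⟩
    have e := h1 2 _ _ hU hP
    rw [h2 2 _ _ hU hP] at e
    simp only [Fin.sum_univ_two, Matrix.cons_val_zero, Matrix.cons_val_one] at e
    have l2 : 0 < Real.log 2 := Real.log_pos one_lt_two
    obtain ⟨A, hA⟩ : ∃ A, A = Real.exp (Real.log (1/4) * (τ * lam) / 2) := ⟨_, rfl⟩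
    obtain ⟨B, hB⟩ : ∃ B, B = Real.exp (Real.log (3/4) * (τ * lam) / 2) := ⟨_, rfl⟩
    have eA : (1/4 : ℝ) ^ (τ * lam) = A * A := by
      rw [Real.rpow_def_of_pos (by norm_num), hA, ← Real.exp_add, add_halves]
    have eB : (3/4 : ℝ) ^ (τ * lam) = B * B := by
      rw [Real.rpow_def_of_pos (by norm_num), hB, ← Real.exp_add, add_halves]
    have pA : 0 < A := hA ▸ Real.exp_pos _
    have pB : 0 < B := hB ▸ Real.exp_pos _
    rw [eA, eB] at e
    have e' : Real.log (1/2 * (A * A) + 1/2 * (B * B)) = Real.log (A * B) := by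
      rw [Real.log_mul pA.ne' pB.ne', hA, hB, Real.log_exp, Real.log_exp, ← hA, ← hB]
      simp only [Real.logb] at e
      generalize Real.log (1/2 * (A * A) + 1/2 * (B * B)) = L at *
      generalize Real.log (1/4) = L1 at *
      generalize Real.log (3/4) = L2 at *
      field_simp at e
      linarith
    have e'' : 1/2 * (A * A) + 1/2 * (B * B) = A * B :=
      Real.log_injOn_pos (by simp; positivity) (by simp; positivity) e'
    have hAB : A = B := by
      have : (A - B) ^ 2 = 0 := by linarith
      have := pow_eq_zero_iff (two_ne_zero) |>.mp this
      linarith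
    rw [hA, hB] at hAB
    have h4 := Real.exp_injective hAB
    have hne : τ * lam ≠ 0 := mul_ne_zero hτ.ne hl
    have h5 : Real.log (1/4) = Real.log (3/4) := by
      apply mul_right_cancel₀ hne
      linarith
    have h6 := Real.log_injOn_pos (show (1/4:ℝ) ∈ Ioi 0 by simp) (show (3/4:ℝ) ∈ Ioi 0 by simp) h5
    norm_num at h6
  rcases disj with h | h
  · exact Or.inl ⟨h, fun h' => excl ⟨h, h'⟩⟩
  · exact Or.inr ⟨h, fun h' => excl ⟨h', h⟩⟩
end

section
/- Let I ⊆ ℝ be a nontrivial interval and let f, g : I → ℝ be continuous and strictly monotone. Suppose that for every n ≥ 2, every weight vector (u_1,…,u_n) ∈ Δ_n with all u_k > 0, and all x_1,…,x_n ∈ I, one has g⁻¹( Σ_{k=1}^n u_k·g(x_k) ) = f⁻¹( Σ_{k=1}^n u_k·f(x_k) ). Then there exist real constants α ≠ 0 and β such that g(x) = α·f(x) + β for all x ∈ I. -/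
open Set

/-- Hardy–Littlewood–Pólya: two continuous strictly monotone functions
generating the same quasi-linear mean on a nontrivial interval are affinely related. -/
theorem quasi_linear_means_equal_iff_affine (I : Set ℝ) (hIoc : I.OrdConnected)
    (hInontriv : ∃ a ∈ I, ∃ b ∈ I, a < b)
    (f g finv ginv : ℝ → ℝ)
    (hfc : ContinuousOn f I) (hgc : ContinuousOn g I)
    (hfm : StrictMonoOn f I ∨ StrictAntiOn f I)
    (hgm : StrictMonoOn g I ∨ StrictAntiOn g I)
    (hfi : ∀ x ∈ I, finv (f x) = x) (hgi : ∀ x ∈ I, ginv (g x) = x)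
    (heq : ∀ n : ℕ, 2 ≤ n → ∀ u : Fin n → ℝ, (∀ k, 0 < u k) → ∑ k, u k = 1 →
      ∀ x : Fin n → ℝ, (∀ k, x k ∈ I) →
      ginv (∑ k, u k * g (x k)) = finv (∑ k, u k * f (x k))) :
    ∃ α : ℝ, α ≠ 0 ∧ ∃ β : ℝ, ∀ x ∈ I, g x = α * f x + β := by
  have hfinj : ∀ x ∈ I, ∀ y ∈ I, x ≠ y → f x ≠ f y := by
    intro x hx y hy hne h
    apply hne
    rw [← hfi x hx, ← hfi y hy, h]
  have hginj : ∀ x ∈ I, ∀ y ∈ I, x ≠ y → g x ≠ g y := by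
    intro x hx y hy hne h
    apply hne
    rw [← hgi x hx, ← hgi y hy, h]
  have hK : Convex ℝ (g '' I) :=
    (hIoc.isPreconnected.image g hgc).ordConnected.convex
  have key : ∀ p ∈ I, ∀ m ∈ I, ∀ q ∈ I, p < m → m < q →
      (g m - g p) * (f q - f p) = (g q - g p) * (f m - f p) := by
    intro p hp m hm q hq hpm hmq
    have hne : f q - f p ≠ 0 := sub_ne_zero.mpr (hfinj q hq p hp (hpm.trans hmq).ne')
    obtain ⟨t, ht0, ht1, ht⟩ : ∃ t : ℝ, 0 < t ∧ t < 1 ∧ t * (f q - f p) = f q - f m := by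
      refine ⟨(f q - f m) / (f q - f p), ?_, ?_, by field_simp⟩
      · rcases hfm with h | h
        · have h1 := h hp hm hpm
          have h2 := h hm hq hmq
          exact div_pos (by linarith) (by linarith)
        · have h1 := h hp hm hpm
          have h2 := h hm hq hmq
          exact div_pos_of_neg_of_neg (by linarith) (by linarith)
      · rcases hfm with h | h
        · have h1 := h hp hm hpm
          have h2 := h hm hq hmq
          rw [div_lt_one (by linarith)]; linarith
        · have h1 := h hp hm hpm
          have h2 := h hm hq hmq
          rw [div_lt_one_of_neg (by linarith)]; linarith
    have e := heq 2 le_rfl ![t, 1 - t]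
      (by intro k; fin_cases k <;> simp <;> linarith) (by simp)
      ![p, q] (by intro k; fin_cases k <;> simp [hp, hq])
    simp only [Fin.sum_univ_two, Matrix.cons_val_zero, Matrix.cons_val_one] at e
    have hf : t * f p + (1 - t) * f q = f m := by linear_combination -ht
    obtain ⟨w, hw, hgw⟩ := hK (mem_image_of_mem g hp) (mem_image_of_mem g hq)
      ht0.le (sub_nonneg.mpr ht1.le) (by ring)
    simp only [smul_eq_mul] at hgw
    rw [hf, ← hgw, hgi w hw, hfi m hm] at e
    subst e
    linear_combination (f q - f p) * hgw - (g q - g p) * ht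
  obtain ⟨a, ha, b, hb, hab⟩ := hInontriv
  have hne : f b - f a ≠ 0 := sub_ne_zero.mpr (hfinj b hb a ha hab.ne')
  have hne' : g b - g a ≠ 0 := sub_ne_zero.mpr (hginj b hb a ha hab.ne')
  have all : ∀ x ∈ I, (g x - g a) * (f b - f a) = (g b - g a) * (f x - f a) := by
    intro x hx
    rcases lt_trichotomy x a with h | h | h
    · linear_combination -key x hx a ha b hb h hab
    · subst h; ring
    · rcases lt_trichotomy x b with h' | h' | h'
      · exact key a ha x hx b hb h h'
      · subst h'; ring
      · linear_combination -key a ha b hb x hx hab h'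
  refine ⟨(g b - g a) / (f b - f a), div_ne_zero hne' hne,
    g a - (g b - g a) / (f b - f a) * f a, fun x hx => ?_⟩
  have h := all x hx
  field_simp
  linear_combination h
end

section
/- Let g : ℝ → ℝ be continuous and strictly monotone with g(0) = 0, and suppose that for every J ∈ ℝ there exist real numbers a(J) and b(J) such that g(z + J) = a(J)·g(z) + b(J) for all z ∈ ℝ. Then either there exists c ≠ 0 with g(z) = c·z for all z, or there exist λ ≠ 0 and γ ≠ 0 with g(z) = (2^{λz} − 1)/γ for all z. -/
theorem additive_linear_aux (f : ℝ → ℝ) (hc : Continuous f)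
    (h0 : f 0 = 0) (h : ∀ x y, f (x + y) = f x + f y) (z : ℝ) : f z = f 1 * z := by
  have := map_real_smul (⟨⟨f, h0⟩, h⟩ : ℝ →+ ℝ) hc z 1
  simp only [smul_eq_mul, mul_one] at this
  rw [mul_comm]
  exact this

/-- the functional equation `g(z + J) = a(J)·g(z) + b(J)` for a continuous
strictly monotone `g` with `g 0 = 0` forces `g` to be linear or of the form
`(2^{λz} − 1)/γ`. -/
theorem linear_or_exponential_of_affine_translation (g : ℝ → ℝ)
    (hc : Continuous g) (hm : StrictMono g ∨ StrictAnti g)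
    (h0 : g 0 = 0)
    (hfe : ∀ J : ℝ, ∃ a b : ℝ, ∀ z : ℝ, g (z + J) = a * g z + b) :
    (∃ c : ℝ, c ≠ 0 ∧ ∀ z, g z = c * z) ∨
    (∃ lam : ℝ, lam ≠ 0 ∧ ∃ γ : ℝ, γ ≠ 0 ∧
      ∀ z, g z = ((2:ℝ) ^ (lam * z) - 1) / γ) := by
  have hinj : Function.Injective g := hm.elim (fun h => h.injective) (fun h => h.injective)
  have h1 : g 1 ≠ 0 := fun h => one_ne_zero (hinj (h.trans h0.symm))
  choose a b hab using hfe
  have hb : ∀ J, b J = g J := fun J => by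
    have := hab J 0
    rw [h0, zero_add] at this
    linarith
  have hg : ∀ z J, g (z + J) = a J * g z + g J := fun z J => by rw [hab, hb]
  obtain ⟨γ, hγ⟩ : ∃ γ, ∀ z, a z = 1 + γ * g z := by
    refine ⟨(a 1 - 1) / g 1, fun z => ?_⟩
    have e1 := hg z 1
    have e2 := hg 1 z
    rw [add_comm] at e2
    field_simp
    linarith
  by_cases h : γ = 0
  · left
    refine ⟨g 1, h1, additive_linear_aux g hc h0 fun x y => ?_⟩
    rw [hg, hγ, h]
    ring
  · right
    have hmul : ∀ x y, 1 + γ * g (x + y) = (1 + γ * g x) * (1 + γ * g y) := fun x y => by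
      rw [hg, hγ]
      ring
    have hne : ∀ x, 1 + γ * g x ≠ 0 := fun x hx => by
      have := hmul x (-x)
      rw [hx, add_neg_cancel, h0] at this
      simp at this
    have hpos : ∀ x, 0 < 1 + γ * g x := fun x => by
      have := hmul (x / 2) (x / 2)
      rw [add_halves] at this
      rw [this]
      exact mul_self_pos.2 (hne _)
    have hl := additive_linear_aux (fun x => Real.log (1 + γ * g x))
      (Continuous.log (by fun_prop) hne) (by simp [h0])
      (fun x y => by simp only [hmul]; exact Real.log_mul (hne x) (hne y))
    have hlog2 : Real.log 2 ≠ 0 := (Real.log_pos one_lt_two).ne'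
    refine ⟨Real.log (1 + γ * g 1) / Real.log 2, ?_, γ, h, fun z => ?_⟩
    · refine div_ne_zero (fun hh => ?_) hlog2
      have := Real.eq_one_of_pos_of_log_eq_zero (hpos 1) hh
      have h2 : γ * g 1 = 0 := by linarith
      exact (mul_ne_zero h h1) h2
    · rw [Real.rpow_def_of_pos two_pos]
      have : Real.log 2 * (Real.log (1 + γ * g 1) / Real.log 2 * z) = Real.log (1 + γ * g z) := by
        rw [hl z]
        field_simp
      rw [this, Real.exp_log (hpos z)]
      field_simp
      ring
end

section
/- Let g : ℝ → ℝ be continuous and strictly monotone, and suppose the quasi-linear mean generated by g is translation invariant: for every n ≥ 1, every (u_1,…,u_n) ∈ Δ_n, all x_1,…,x_n ∈ ℝ and every t ∈ ℝ, g⁻¹( Σ_{k=1}^n u_k·g(x_k + t) ) = g⁻¹( Σ_{k=1}^n u_k·g(x_k) ) + t. Then either g is affine, g(z) = a·z + b with a ≠ 0, or there exist α ≠ 0, β ∈ ℝ and λ ≠ 0 such that g(z) = α·2^{λz} + β for all z ∈ ℝ. -/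
open Set

lemma aux_lin_s6 (h : ℝ → ℝ) (hc : Continuous h) (ha : ∀ x y, h (x + y) = h x + h y) :
    ∀ z, h z = h 1 * z := by
  intro z
  have := map_real_smul (AddMonoidHom.mk' h ha) hc z 1
  simpa [mul_comm] using this

lemma aux_mid (g ginv : ℝ → ℝ)
    (hc : Continuous g) (hm : StrictMono g ∨ StrictAnti g)
    (hgi : ∀ x, ginv (g x) = x)
    (hti : ∀ (n : ℕ), 1 ≤ n → ∀ (u : Fin n → ℝ), IsDist u →
      ∀ (x : Fin n → ℝ) (t : ℝ),
      ginv (∑ k, u k * g (x k + t)) = ginv (∑ k, u k * g (x k)) + t)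
    (x m y t : ℝ) (hxm : x ≤ m) (hmy : m ≤ y) :
    (g (m + t) - g (x + t)) * (g y - g x) = (g m - g x) * (g (y + t) - g (x + t)) := by
  rcases (hxm.trans hmy).eq_or_lt with h | hxy
  · have : m = x := by linarith
    subst this; subst h; ring
  have hne : g y - g x ≠ 0 := by
    rcases hm with hm | hm
    · have := hm hxy; intro h; linarith
    · have := hm hxy; intro h; linarith
  obtain ⟨s, hs⟩ : ∃ s, s = (g m - g x) / (g y - g x) := ⟨_, rfl⟩
  have hs' : s * (g y - g x) = g m - g x := by rw [hs]; field_simp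
  have h01 : 0 ≤ s ∧ s ≤ 1 := by
    rcases hm with hm | hm
    · have h1 := hm hxy
      have h2 := hm.monotone hxm
      have h3 := hm.monotone hmy
      rw [hs]
      exact ⟨div_nonneg (by linarith) (by linarith), (div_le_one (by linarith)).2 (by linarith)⟩
    · have h1 := hm hxy
      have h2 := hm.antitone hxm
      have h3 := hm.antitone hmy
      rw [hs]
      exact ⟨div_nonneg_of_nonpos (by linarith) (by linarith),
        (div_le_one_of_neg (by linarith)).2 (by linarith)⟩
  have key := hti 2 (by norm_num) ![1 - s, s]
    ⟨by intro i; fin_cases i <;> simp <;> linarith, by simp⟩ ![x, y] t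
  simp only [Fin.sum_univ_two, Matrix.cons_val_zero, Matrix.cons_val_one] at key
  have e1 : (1 - s) * g x + s * g y = g m := by linarith
  rw [e1, hgi] at key
  have hmem : (1 - s) * g (x + t) + s * g (y + t) ∈ uIcc (g (x + t)) (g (y + t)) := by
    rw [← segment_eq_uIcc]
    exact ⟨1 - s, s, by linarith, h01.1, by ring, by simp⟩
  obtain ⟨w, -, hw⟩ := intermediate_value_uIcc hc.continuousOn hmem
  rw [← hw, hgi] at key
  rw [key] at hw
  rw [hw, ← hs']; ring

lemma aux_all (g : ℝ → ℝ)
    (h : ∀ x m y t : ℝ, x ≤ m → m ≤ y →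
    (g (m + t) - g (x + t)) * (g y - g x) = (g m - g x) * (g (y + t) - g (x + t))) (z t : ℝ) :
    (g (z + t) - g (0 + t)) * (g 1 - g 0) = (g z - g 0) * (g (1 + t) - g (0 + t)) := by
  rcases le_total z 0 with h0 | h0
  · linarith [h z 0 1 t h0 zero_le_one]
  rcases le_total z 1 with h1 | h1
  · linarith [h 0 z 1 t h0 h1]
  · linarith [h 0 1 z t zero_le_one h1]

/-- a translation-invariant quasi-linear mean is generated by an affine
or an exponential function. -/
theorem translation_invariant_quasilinear_mean (g ginv : ℝ → ℝ)
    (hc : Continuous g) (hm : StrictMono g ∨ StrictAnti g)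
    (hgi : ∀ x, ginv (g x) = x)
    (hti : ∀ (n : ℕ), 1 ≤ n → ∀ (u : Fin n → ℝ), IsDist u →
      ∀ (x : Fin n → ℝ) (t : ℝ),
      ginv (∑ k, u k * g (x k + t)) = ginv (∑ k, u k * g (x k)) + t) :
    (∃ a : ℝ, a ≠ 0 ∧ ∃ b : ℝ, ∀ z, g z = a * z + b) ∨
    (∃ α : ℝ, α ≠ 0 ∧ ∃ β : ℝ, ∃ lam : ℝ, lam ≠ 0 ∧
      ∀ z, g z = α * (2:ℝ) ^ (lam * z) + β) := by
  have hall := aux_all g (fun x m y t => aux_mid g ginv hc hm hgi hti x m y t)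
  obtain ⟨d, hd⟩ : ∃ d, d = g 1 - g 0 := ⟨_, rfl⟩
  have hd0 : d ≠ 0 := by
    intro h
    have : g 1 = g 0 := by linarith
    have h2 := congrArg ginv this
    rw [hgi, hgi] at h2
    norm_num at h2
  obtain ⟨f, hf⟩ : ∃ f : ℝ → ℝ, ∀ z, f z = (g z - g 0) / d := ⟨_, fun _ => rfl⟩
  have hfg : ∀ z, g z = d * f z + g 0 := by intro z; rw [hf]; field_simp; ring
  have hfc : Continuous f := by
    have : f = fun z => (g z - g 0) / d := funext hf
    rw [this]; fun_prop
  have hf1 : f 1 = 1 := by rw [hf, ← hd]; field_simp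
  have hft : ∀ z t, f (z + t) = (f (1 + t) - f t) * f z + f t := by
    intro z t
    have := hall z t
    rw [← hd, zero_add, hfg (z + t), hfg t, hfg z, hfg (1 + t)] at this
    have h2 : d * d * (f (z + t) - ((f (1 + t) - f t) * f z + f t)) = 0 := by linarith
    have := (mul_eq_zero.1 h2).resolve_left (mul_ne_zero hd0 hd0)
    linarith
  obtain ⟨c, hcdef⟩ : ∃ c, c = f (1 + 1) - f 1 - 1 := ⟨_, rfl⟩
  have hadd : ∀ z t, f (z + t) = f z + f t + c * f t * f z := by
    intro z t
    have h1 := hft t 1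
    have h2 := hft z t
    rw [add_comm t 1] at h1
    rw [h2, h1, hf1, hcdef, hf1]; ring
  by_cases hc0 : c = 0
  · left
    have := aux_lin_s6 f hfc (by intro x y; rw [hadd, hc0]; ring)
    refine ⟨d, hd0, g 0, fun z => ?_⟩
    rw [hfg z, this z, hf1, one_mul]
  · right
    have hA : ∀ z t, 1 + c * f (z + t) = (1 + c * f z) * (1 + c * f t) := by
      intro z t; rw [hadd]; ring
    have hf0 : f 0 = 0 := by rw [hf]; simp
    have hpos : ∀ z, 0 < 1 + c * f z := by
      intro z
      have hne : ∀ w, 1 + c * f w ≠ 0 := by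
        intro w hw
        have := hA w (-w)
        rw [hw, add_neg_cancel, hf0] at this
        norm_num at this
      have := hA (z / 2) (z / 2)
      rw [add_halves] at this
      rw [this]
      exact mul_self_pos.2 (hne _)
    have hlin := aux_lin_s6 (fun z => Real.log (1 + c * f z))
      (Continuous.log (by fun_prop) (fun z => (hpos z).ne'))
      (by intro x y; rw [hA, Real.log_mul (hpos x).ne' (hpos y).ne'])
    simp only [hf1, mul_one] at hlin
    have hl2 : Real.log 2 ≠ 0 := (Real.log_pos (by norm_num)).ne'
    have h1 := hpos 1
    rw [hf1, mul_one] at h1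
    refine ⟨d / c, div_ne_zero hd0 hc0, g 0 - d / c, Real.log (1 + c) / Real.log 2,
      div_ne_zero (Real.log_ne_zero_of_pos_of_ne_one h1 (by simpa using hc0)) hl2, fun z => ?_⟩
    have e : (2:ℝ) ^ (Real.log (1 + c) / Real.log 2 * z) = 1 + c * f z := by
      rw [Real.rpow_def_of_pos (by norm_num), ← Real.exp_log (hpos z), hlin z]
      congr 1; field_simp
    rw [e, hfg z]; field_simp; ring
end

section
/- Let h_I : ℝ → ℝ be continuous strictly increasing with h_I(0) = 0 and h_I(x) > 0 for x > 0, and let h_C : ℝ → (0,∞) be continuous strictly decreasing with h_C(x) → 0 as x → +∞. Fix τ < 0 and λ ∈ ℝ, and for each n ≥ 1, U ∈ Δ_n, P ∈ Δ_n⁺ define Φ(U; P) = Σ_{k=1}^n u_k·τ·log₂ p_k if λ = 0, and Φ(U; P) = (1/λ)·log₂( Σ_{k=1}^n u_k·p_k^{τλ} ) if λ ≠ 0; define the certainty measure C(U; P) = h_C(Φ(U; P)). Let g be a continuous strictly monotone real function defined on the range of h_C, set I(U; P) = g(C(U; P)), and assume: (i) I(U; P) > 0 whenever Φ(U; P) >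 0, I takes values in the range of h_I, and (ii) h_I⁻¹( I(U⋆V; P⋆Q) ) = h_I⁻¹( I(U; P) ) + h_I⁻¹( I(V; Q) ) for all n, m, U ∈ Δ_n, V ∈ Δ_m, P ∈ Δ_n⁺, Q ∈ Δ_m⁺. Then there exists k > 0 such that g(y) = h_I( k·h_C⁻¹(y) ) for all y in the range of C; in particular I(U; P) = h_I( k·Φ(U; P) ) for all n, U, P. -/
open Set

theorem aux_lin_s7 (F : ℝ → ℝ) (hadd : ∀ x y, 0 ≤ x → 0 ≤ y → F (x + y) = F x + F y)
    (hpos : ∀ x, 0 < x → 0 < F x) (x : ℝ) (hx : 0 ≤ x) : F x = F 1 * x := by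
  have h0 : F 0 = 0 := by
    have := hadd 0 0 le_rfl le_rfl
    simp at this
    exact this
  have hn : ∀ (n : ℕ) (y : ℝ), 0 ≤ y → F (n * y) = n * F y := by
    intro n y hy
    induction n with
    | zero => simp [h0]
    | succ n ih =>
      have : ((n + 1 : ℕ) : ℝ) * y = n * y + y := by push_cast; ring
      rw [this, hadd _ _ (by positivity) hy, ih]
      push_cast; ring
  have hmono : ∀ a b, 0 ≤ a → a ≤ b → F a ≤ F b := by
    intro a b ha hab
    rcases hab.eq_or_lt with h | h
    · rw [h]
    · have := hadd a (b - a) ha (by linarith)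
      have h2 := hpos (b - a) (by linarith)
      rw [add_sub_cancel] at this
      linarith
  have h1 : 0 < F 1 := hpos 1 one_pos
  have key : ∀ n : ℕ, (n : ℝ) * |F x - F 1 * x| ≤ F 1 := by
    intro n
    have hnx : 0 ≤ (n : ℝ) * x := by positivity
    have hf1 := Nat.floor_le hnx
    have hf2 := (Nat.lt_floor_add_one ((n : ℝ) * x)).le
    have e1 := hmono _ _ (Nat.cast_nonneg _) hf1
    have e2 := hmono _ _ hnx hf2
    have e3 := hn (⌊(n : ℝ) * x⌋₊) 1 zero_le_one
    rw [mul_one] at e3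
    rw [hn n x hx] at e1 e2
    rw [hadd _ _ (Nat.cast_nonneg _) zero_le_one] at e2
    rw [e3] at e1 e2
    have hnn : |(n : ℝ)| = n := abs_of_nonneg (Nat.cast_nonneg _)
    rw [← hnn, ← abs_mul, abs_le]
    constructor <;> nlinarith
  by_contra hne
  have hd : 0 < |F x - F 1 * x| := abs_pos.mpr (sub_ne_zero.mpr hne)
  obtain ⟨n, hn'⟩ := exists_nat_gt (F 1 / |F x - F 1 * x|)
  rw [div_lt_iff₀ hd] at hn'
  linarith [key n]

theorem aux_sum_pos {n : ℕ} (U w : Fin n → ℝ) (hU : IsDist U) (hw : ∀ i, 0 < w i) :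
    0 < ∑ i, U i * w i := by
  have hne : ∃ i, 0 < U i := by
    by_contra! h
    have h1 := Finset.sum_nonpos (fun i (_ : i ∈ Finset.univ) => h i)
    have := hU.2
    linarith
  obtain ⟨i, hi⟩ := hne
  exact Finset.sum_pos' (fun j _ => mul_nonneg (hU.1 j) (hw j).le)
    ⟨i, Finset.mem_univ _, mul_pos hi (hw i)⟩

theorem aux_sum_prod {n m : ℕ} (f : Fin n → Fin m → ℝ) :
    ∑ i : Fin (n * m), f (finProdFinEquiv.symm i).1 (finProdFinEquiv.symm i).2
      = ∑ i, ∑ j, f i j := by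
  rw [← Fintype.sum_prod_type']
  exact Equiv.sum_comp finProdFinEquiv.symm (fun x : Fin n × Fin m => f x.1 x.2)

noncomputable def auxPhi (τ lam : ℝ) (n : ℕ) (U P : Fin n → ℝ) : ℝ :=
  if lam = 0 then ∑ k, U k * (τ * Real.logb 2 (P k))
      else (1 / lam) * Real.logb 2 (∑ k, U k * P k ^ (τ * lam))

theorem auxPhi_add (τ lam : ℝ) {n m : ℕ} (U P : Fin n → ℝ) (V Q : Fin m → ℝ)
    (hU : IsDist U) (hV : IsDist V) (hP : IsPosDist P) (hQ : IsPosDist Q) :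
    auxPhi τ lam (n * m) (prodDist U V) (prodDist P Q)
      = auxPhi τ lam n U P + auxPhi τ lam m V Q := by
  unfold auxPhi prodDist
  split_ifs with h
  · rw [aux_sum_prod (fun i j => U i * V j * (τ * Real.logb 2 (P i * Q j)))]
    have : ∀ i j, U i * V j * (τ * Real.logb 2 (P i * Q j))
        = (U i * (τ * Real.logb 2 (P i))) * V j + U i * (V j * (τ * Real.logb 2 (Q j))) := by
      intro i j
      rw [Real.logb_mul (hP.1 i).ne' (hQ.1 j).ne']; ring
    simp_rw [this, Finset.sum_add_distrib, ← Finset.mul_sum, ← Finset.sum_mul, hU.2, hV.2]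
    ring
  · rw [aux_sum_prod (fun i j => U i * V j * (P i * Q j) ^ (τ * lam))]
    have : ∀ i j, U i * V j * (P i * Q j) ^ (τ * lam)
        = (U i * P i ^ (τ * lam)) * (V j * Q j ^ (τ * lam)) := by
      intro i j
      rw [Real.mul_rpow (hP.1 i).le (hQ.1 j).le]; ring
    simp_rw [this, ← Finset.mul_sum, ← Finset.sum_mul]
    rw [Real.logb_mul, mul_add]
    · exact (aux_sum_pos _ _ hU fun i => Real.rpow_pos_of_pos (hP.1 i) _).ne'
    · exact (aux_sum_pos _ _ hV fun i => Real.rpow_pos_of_pos (hQ.1 i) _).ne'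

theorem auxPhi_nonneg (τ lam : ℝ) (hτ : τ < 0) {n : ℕ} (U P : Fin n → ℝ)
    (hU : IsDist U) (hP : IsPosDist P) : 0 ≤ auxPhi τ lam n U P := by
  have hP1 : ∀ i, P i ≤ 1 := fun i => by
    rw [← hP.2]
    exact Finset.single_le_sum (fun j _ => (hP.1 j).le) (Finset.mem_univ i)
  unfold auxPhi
  split_ifs with h
  · refine Finset.sum_nonneg fun i _ => mul_nonneg (hU.1 i) ?_
    exact mul_nonneg_of_nonpos_of_nonpos hτ.le
      (Real.logb_nonpos one_lt_two (hP.1 i).le (hP1 i))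
  · rcases lt_or_gt_of_ne h with hl | hl
    · apply mul_nonneg_of_nonpos_of_nonpos (one_div_neg.mpr hl).le
      apply Real.logb_nonpos one_lt_two
        (aux_sum_pos _ _ hU fun i => Real.rpow_pos_of_pos (hP.1 i) _).le
      rw [← hU.2]
      refine Finset.sum_le_sum fun i _ => mul_le_of_le_one_right (hU.1 i) ?_
      exact Real.rpow_le_one (hP.1 i).le (hP1 i) (mul_pos_of_neg_of_neg hτ hl).le
    · apply mul_nonneg (one_div_pos.mpr hl).le
      apply Real.logb_nonneg one_lt_two
      rw [← hU.2]
      refine Finset.sum_le_sum fun i _ => le_mul_of_one_le_right (hU.1 i) ?_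
      exact Real.one_le_rpow_of_pos_of_le_one_of_nonpos (hP.1 i) (hP1 i)
        (mul_neg_of_neg_of_pos hτ hl).le

theorem auxPhi_surj (τ lam : ℝ) (hτ : τ < 0) (x : ℝ) (hx : 0 ≤ x) :
    ∃ (n : ℕ) (U P : Fin n → ℝ), IsDist U ∧ IsPosDist P ∧ auxPhi τ lam n U P = x := by
  rcases hx.eq_or_lt with h | h
  · refine ⟨1, fun _ => 1, fun _ => 1, ⟨by simp, by simp⟩, ⟨by simp, by simp⟩, ?_⟩
    simp [auxPhi, ← h]
  · have hp : (0 : ℝ) < 2 ^ (x / τ) := by positivity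
    have hp1 : (2 : ℝ) ^ (x / τ) < 1 :=
      Real.rpow_lt_one_of_one_lt_of_neg one_lt_two (div_neg_of_pos_of_neg h hτ)
    refine ⟨2, ![1, 0], ![2 ^ (x / τ), 1 - 2 ^ (x / τ)], ⟨?_, by simp⟩, ⟨?_, by simp⟩, ?_⟩
    · intro i; fin_cases i <;> simp
    · intro i; fin_cases i
      · simpa using hp
      · simpa using hp1
    · have hτ0 : τ ≠ 0 := hτ.ne
      have h2 : Real.logb 2 ((2 : ℝ) ^ (x / τ)) = x / τ :=
        Real.logb_rpow two_pos (by norm_num)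
      unfold auxPhi
      split_ifs with hl
      · simp only [Fin.sum_univ_two, Matrix.cons_val_zero, Matrix.cons_val_one, h2]
        field_simp
        ring
      · simp only [Fin.sum_univ_two, Matrix.cons_val_zero, Matrix.cons_val_one, one_mul,
          zero_mul, add_zero]
        rw [Real.logb_rpow_eq_mul_logb_of_pos hp, h2]
        field_simp

/-- Theorem 2 of the paper: a pseudo-additive inaccuracy measure which is
a monotone function `g` of the certainty measure `C = h_C ∘ Φ` must satisfy
`g(y) = h_I(k · h_C⁻¹(y))`, i.e. `I = h_I ∘ (k·Φ)`. -/
theorem information_from_certainty (hI hIinv hC hCinv : ℝ → ℝ)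
    (hIc : Continuous hI) (hIm : StrictMono hI) (hI0 : hI 0 = 0)
    (hIpos : ∀ x : ℝ, 0 < x → 0 < hI x)
    (hIli : ∀ x : ℝ, hIinv (hI x) = x)
    (hCc : Continuous hC) (hCm : StrictAnti hC) (hCpos : ∀ x : ℝ, 0 < hC x)
    (hClim : Filter.Tendsto hC Filter.atTop (nhds 0))
    (hCli : ∀ x : ℝ, hCinv (hC x) = x)
    (τ lam : ℝ) (hτ : τ < 0)
    (Φ : ∀ n : ℕ, (Fin n → ℝ) → (Fin n → ℝ) → ℝ)
    (hΦ : ∀ (n : ℕ) (U P : Fin n → ℝ), Φ n U P =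
      if lam = 0 then ∑ k, U k * (τ * Real.logb 2 (P k))
      else (1 / lam) * Real.logb 2 (∑ k, U k * P k ^ (τ * lam)))
    (g : ℝ → ℝ)
    (hgc : ContinuousOn g (range hC))
    (hgm : StrictMonoOn g (range hC) ∨ StrictAntiOn g (range hC))
    (hIposHyp : ∀ (n : ℕ) (U P : Fin n → ℝ), IsDist U → IsPosDist P →
      0 < Φ n U P → 0 < g (hC (Φ n U P)))
    (hIrange : ∀ (n : ℕ) (U P : Fin n → ℝ), IsDist U → IsPosDist P →
      g (hC (Φ n U P)) ∈ range hI)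
    (haddI : ∀ (n m : ℕ) (U : Fin n → ℝ) (V : Fin m → ℝ) (P : Fin n → ℝ)
      (Q : Fin m → ℝ), IsDist U → IsDist V → IsPosDist P → IsPosDist Q →
      hIinv (g (hC (Φ (n * m) (prodDist U V) (prodDist P Q)))) =
        hIinv (g (hC (Φ n U P))) + hIinv (g (hC (Φ m V Q)))) :
    ∃ k : ℝ, 0 < k ∧
      (∀ y : ℝ, (∃ (n : ℕ) (U P : Fin n → ℝ),
          IsDist U ∧ IsPosDist P ∧ hC (Φ n U P) = y) →
        g y = hI (k * hCinv y)) ∧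
      (∀ (n : ℕ) (U P : Fin n → ℝ), IsDist U → IsPosDist P →
        g (hC (Φ n U P)) = hI (k * Φ n U P)) := by
  have hΦ' : ∀ n U P, Φ n U P = auxPhi τ lam n U P := hΦ
  have hS : ∀ x, 0 ≤ x → ∃ (n : ℕ) (U P : Fin n → ℝ),
      IsDist U ∧ IsPosDist P ∧ Φ n U P = x := by
    intro x hx
    simpa only [hΦ'] using auxPhi_surj τ lam hτ x hx
  have hF : ∀ x, 0 ≤ x → hI (hIinv (g (hC x))) = g (hC x) := by
    intro x hx
    obtain ⟨n, U, P, hU, hP, rfl⟩ := hS x hx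
    obtain ⟨z, hz⟩ := hIrange n U P hU hP
    rw [← hz, hIli]
  have hadd : ∀ x y, 0 ≤ x → 0 ≤ y → hIinv (g (hC (x + y))) =
      hIinv (g (hC x)) + hIinv (g (hC y)) := by
    intro x y hx hy
    obtain ⟨n, U, P, hU, hP, rfl⟩ := hS x hx
    obtain ⟨m, V, Q, hV, hQ, rfl⟩ := hS y hy
    rw [← haddI n m U V P Q hU hV hP hQ]
    simp only [hΦ']
    rw [auxPhi_add τ lam U P V Q hU hV hP hQ]
  have hpos : ∀ x, 0 < x → 0 < hIinv (g (hC x)) := by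
    intro x hx
    have h1 := hF x hx.le
    obtain ⟨n, U, P, hU, hP, rfl⟩ := hS x hx.le
    have h2 := hIposHyp n U P hU hP hx
    rw [← h1, ← hI0] at h2
    exact hIm.lt_iff_lt.mp h2
  have main : ∀ (n : ℕ) (U P : Fin n → ℝ), IsDist U → IsPosDist P →
      g (hC (Φ n U P)) = hI (hIinv (g (hC 1)) * Φ n U P) := by
    intro n U P hU hP
    have h0 : 0 ≤ Φ n U P := by rw [hΦ']; exact auxPhi_nonneg τ lam hτ U P hU hP
    rw [← aux_lin_s7 (fun x => hIinv (g (hC x))) hadd hpos _ h0, hF _ h0]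
  refine ⟨hIinv (g (hC 1)), hpos 1 one_pos, ?_, main⟩
  rintro y ⟨n, U, P, hU, hP, rfl⟩
  rw [hCli]
  exact main n U P hU hP
end

section
/- Let h : ℝ → ℝ be continuous, strictly increasing, with h(0) = 0, and suppose there exists a polynomial F in two real variables such that h(x + y) = F(h(x), h(y)) for all x, y ∈ ℝ. Then either there exists a > 0 such that h(x) = a·x for all x (and then h(x+y) = h(x) + h(y)), or there exist c, e ∈ ℝ with c·e > 0 such that h(x) = (2^{c·x} − 1)/e for all x (and then h(x+y) = h(x) + h(y) + e·h(x)·h(y)). -/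
theorem poly_aux (F : MvPolynomial (Fin 2) ℝ) (u v : ℝ) :
    MvPolynomial.eval ![u, v] F =
      (MvPolynomial.aeval ![Polynomial.X, Polynomial.C v] F : Polynomial ℝ).eval u := by
  induction F using MvPolynomial.induction_on with
  | C a => simp
  | add p q hp hq => simp [hp, hq]
  | mul_X p i hp =>
    rw [map_mul, map_mul, Polynomial.eval_mul, hp]
    fin_cases i <;> simp

theorem additive_aux (g : ℝ → ℝ) (hc : Continuous g)
    (hadd : ∀ x y, g (x + y) = g x + g y) : ∀ x, g x = g 1 * x := by
  intro x
  have := map_real_smul (AddMonoidHom.mk' g hadd) hc x 1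
  simp at this
  rw [this, mul_comm]

/-- polynomial addition theorem, information case: a continuous strictly
increasing `h` with `h 0 = 0` satisfying a polynomial addition theorem is either linear
(additive) or of the form `(2^{cx} − 1)/e` with `c·e > 0` (pseudo-additive). -/
theorem poly_addition_information (h : ℝ → ℝ)
    (hc : Continuous h) (hm : StrictMono h) (h0 : h 0 = 0)
    (hpoly : ∃ F : MvPolynomial (Fin 2) ℝ, ∀ x y : ℝ,
      h (x + y) = MvPolynomial.eval ![h x, h y] F) :
    (∃ a : ℝ, 0 < a ∧ (∀ x : ℝ, h x = a * x) ∧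
      ∀ x y : ℝ, h (x + y) = h x + h y) ∨
    (∃ c e : ℝ, 0 < c * e ∧ (∀ x : ℝ, h x = ((2:ℝ) ^ (c * x) - 1) / e) ∧
      ∀ x y : ℝ, h (x + y) = h x + h y + e * h x * h y) := by
  obtain ⟨F, hF⟩ := hpoly
  have key : ∀ y : ℝ, ∃ P : Polynomial ℝ, ∀ x, h (x + y) = P.eval (h x) := by
    intro y
    refine ⟨MvPolynomial.aeval ![Polynomial.X, Polynomial.C (h y)] F, fun x => ?_⟩
    rw [hF x y]
    exact poly_aux F _ _
  choose P hP using key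
  have hinf : (Set.range h).Infinite := Set.infinite_range_of_injective hm.injective
  have hcomp : ∀ y, (P y).comp (P (-y)) = Polynomial.X := by
    intro y
    apply Polynomial.eq_of_infinite_eval_eq
    apply hinf.mono
    rintro _ ⟨x, rfl⟩
    simp only [Set.mem_ofPred_eq, Polynomial.eval_comp, Polynomial.eval_X]
    rw [← hP, ← hP]
    congr 1
    ring
  have hlin : ∀ y, ∃ A : ℝ, ∀ x, h (x + y) = A * h x + h y := by
    intro y
    have h1 := congrArg Polynomial.natDegree (hcomp y)
    rw [Polynomial.natDegree_comp, Polynomial.natDegree_X] at h1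
    have h2 : (P y).natDegree = 1 := Nat.eq_one_of_mul_eq_one_right h1
    obtain ⟨a, b, hab⟩ := Polynomial.exists_eq_X_add_C_of_natDegree_le_one h2.le
    refine ⟨a, fun x => ?_⟩
    have h3 := hP y x
    have h4 := hP y 0
    rw [hab] at h3 h4
    simp [h0] at h3 h4
    rw [h3, h4]
  choose A hA using hlin
  have h1pos : 0 < h 1 := by rw [← h0]; exact hm one_pos
  obtain ⟨e, he⟩ : ∃ e, ∀ x y : ℝ, h (x + y) = h x + h y + e * h x * h y := by
    refine ⟨(A 1 - 1) / h 1, fun x y => ?_⟩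
    have h5 := hA y 1
    have h6 := hA 1 y
    rw [add_comm y 1] at h6
    have h7 : A y = 1 + (A 1 - 1) / h 1 * h y := by
      field_simp
      linarith
    rw [hA y x, h7]
    ring
  by_cases he0 : e = 0
  · left
    subst he0
    have hadd : ∀ x y, h (x + y) = h x + h y := fun x y => by rw [he]; ring
    exact ⟨h 1, h1pos, additive_aux h hc hadd, hadd⟩
  · right
    have hmul : ∀ x y, 1 + e * h (x + y) = (1 + e * h x) * (1 + e * h y) := fun x y => by
      rw [he]; ring
    have hne : ∀ x, 1 + e * h x ≠ 0 := by
      intro x hx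
      have := hmul x (-x)
      rw [hx] at this
      simp [h0] at this
    have hpos : ∀ x, 0 < 1 + e * h x := by
      intro x
      have := hmul (x / 2) (x / 2)
      rw [add_halves] at this
      rw [this]
      exact mul_self_pos.2 (hne _)
    have hlog := additive_aux (fun x => Real.log (1 + e * h x))
      (Continuous.log (by fun_prop) hne)
      (fun x y => by simp only [hmul]; exact Real.log_mul (hne x) (hne y))
    have hl2 : 0 < Real.log 2 := Real.log_pos one_lt_two
    set k := Real.log (1 + e * h 1) with hk
    have hform : ∀ x, h x = ((2:ℝ) ^ (k / Real.log 2 * x) - 1) / e := by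
      intro x
      rw [Real.rpow_def_of_pos two_pos]
      have : Real.log 2 * (k / Real.log 2 * x) = Real.log (1 + e * h x) := by
        rw [hlog x]
        field_simp
      rw [this, Real.exp_log (hpos x)]
      field_simp
      ring
    refine ⟨k / Real.log 2, e, ?_, hform, he⟩
    rw [div_mul_eq_mul_div]
    apply div_pos _ hl2
    rcases lt_or_gt_of_ne he0 with hneg | hp
    · apply mul_pos_of_neg_of_neg _ hneg
      exact Real.log_neg (hpos 1) (by nlinarith)
    · apply mul_pos _ hp
      exact Real.log_pos (by nlinarith)
end

section
/- Let h : ℝ → (0,∞) be continuous, strictly decreasing, with h(x) → 0 as x → +∞, and suppose there exists a polynomial F in two real variables such that h(x + y) = F(h(x), h(y)) for all x, y ∈ ℝ. Then there exist c, e ∈ ℝ with c·e > 0 such that h(x) = 2^{−c·x}/e for all x ∈ ℝ, and consequently h(x + y) = e·h(x)·h(y) for all x, y. In particular, no function of the form h(x) = a·x + b satisfies these hypotheses. -/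
/-- polynomial addition theorem, certainty case: a continuous strictly
decreasing positive `h` with `h(x) → 0` as `x → +∞` satisfying a polynomial addition
theorem is `2^{−cx}/e` with `c·e > 0`, hence multiplicative; no affine function
satisfies the hypotheses. -/
theorem poly_addition_certainty (h : ℝ → ℝ)
    (hc : Continuous h) (hm : StrictAnti h)
    (hpos : ∀ x : ℝ, 0 < h x)
    (hlim : Filter.Tendsto h Filter.atTop (nhds 0))
    (hpoly : ∃ F : MvPolynomial (Fin 2) ℝ, ∀ x y : ℝ,
      h (x + y) = MvPolynomial.eval ![h x, h y] F) :
    (∃ c e : ℝ, 0 < c * e ∧ (∀ x : ℝ, h x = (2:ℝ) ^ (-(c * x)) / e) ∧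
      ∀ x y : ℝ, h (x + y) = e * h x * h y) ∧
    (∀ a b : ℝ, ¬ (StrictAnti (fun x : ℝ => a * x + b) ∧
      (∀ x : ℝ, 0 < a * x + b) ∧
      Filter.Tendsto (fun x : ℝ => a * x + b) Filter.atTop (nhds 0))) := by
  constructor
  · obtain ⟨F, hF⟩ := hpoly
    have hP : ∀ y : ℝ, ∃ p : Polynomial ℝ, ∀ t, p.eval t = MvPolynomial.eval ![t, h y] F := by
      intro y
      refine ⟨MvPolynomial.aeval ![Polynomial.X, Polynomial.C (h y)] F, fun t => ?_⟩
      clear hF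
      induction F using MvPolynomial.induction_on with
      | C a => simp
      | add p q hp hq => simp [hp, hq]
      | mul_X p i hp => fin_cases i <;> simp [hp]
    choose p hp using hP
    have hpx : ∀ x y, (p y).eval (h x) = h (x + y) := fun x y => by rw [hp, hF]
    have hinf : (Set.range h).Infinite := Set.infinite_range_of_injective hm.injective
    have hcomp : ∀ y, (p y).comp (p (-y)) = Polynomial.X := by
      intro y
      apply Polynomial.eq_of_infinite_eval_eq
      refine hinf.mono ?_
      rintro _ ⟨x, rfl⟩
      simp [Polynomial.eval_comp, hpx]
    have hdeg : ∀ y, (p y).natDegree = 1 := by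
      intro y
      have := congrArg Polynomial.natDegree (hcomp y)
      rw [Polynomial.natDegree_comp, Polynomial.natDegree_X] at this
      exact Nat.eq_one_of_mul_eq_one_right this
    have h0 : ∀ y, (p y).eval 0 = 0 := by
      intro y
      have h1 : Filter.Tendsto (fun x => (p y).eval (h x)) Filter.atTop
          (nhds ((p y).eval 0)) := ((p y).continuous.tendsto 0).comp hlim
      have h2 : Filter.Tendsto (fun x => (p y).eval (h x)) Filter.atTop (nhds 0) := by
        simp only [hpx]
        exact hlim.comp (Filter.tendsto_atTop_add_const_right _ y Filter.tendsto_id)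
      exact tendsto_nhds_unique h1 h2
    have hA : ∀ y, ∃ A : ℝ, ∀ x, h (x + y) = A * h x := by
      intro y
      obtain ⟨a, b, hab⟩ := Polynomial.exists_eq_X_add_C_of_natDegree_le_one (hdeg y).le
      refine ⟨a, fun x => ?_⟩
      have hb := h0 y
      rw [hab] at hb
      simp at hb
      rw [← hpx, hab, hb]
      simp
    have hmul : ∀ x y, h (x + y) = (h 0)⁻¹ * h x * h y := by
      intro x y
      obtain ⟨A, hA⟩ := hA y
      have h1 := hA 0
      rw [zero_add] at h1
      have := (hpos 0).ne'
      rw [hA x, h1]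
      field_simp
    let L : ℝ →+ ℝ := AddMonoidHom.mk' (fun x => Real.log (h x / h 0)) (by
      intro x y
      have := (hpos 0).ne'
      have := (hpos x).ne'
      have := (hpos y).ne'
      rw [← Real.log_mul (by positivity) (by positivity), hmul]
      congr 1
      field_simp)
    have hL : Continuous L :=
      (hc.div_const _).log (fun x => (div_pos (hpos x) (hpos 0)).ne')
    have hlin : ∀ x, Real.log (h x / h 0) = x * Real.log (h 1 / h 0) := by
      intro x
      have := map_real_smul L hL x 1
      simpa [L] using this
    have hneg : Real.log (h 1 / h 0) < 0 :=
      Real.log_neg (div_pos (hpos 1) (hpos 0)) ((div_lt_one (hpos 0)).2 (hm one_pos))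
    have hl2 : 0 < Real.log 2 := Real.log_pos one_lt_two
    refine ⟨-Real.log (h 1 / h 0) / Real.log 2, (h 0)⁻¹, ?_, ?_, hmul⟩
    · exact mul_pos (div_pos (neg_pos.2 hneg) hl2) (inv_pos.2 (hpos 0))
    · intro x
      rw [Real.rpow_def_of_pos two_pos]
      have : Real.log 2 * -(-Real.log (h 1 / h 0) / Real.log 2 * x)
          = Real.log (h x / h 0) := by
        rw [hlin x]
        field_simp
      rw [this, Real.exp_log (div_pos (hpos x) (hpos 0))]
      have := (hpos 0).ne'
      field_simp
  · rintro a b ⟨hs, hp, -⟩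
    have ha : a ≠ 0 := by
      rintro rfl
      have := hs (one_pos (α := ℝ))
      simp at this
    have := hp (-b / a)
    rw [mul_div_cancel₀ _ ha] at this
    simp at this
end

section
/- Let e ≠ 0 and let EI : (0,1] → ℝ be continuous, strictly decreasing, with EI(1) = 0, EI(p) > 0 for p ∈ (0,1), and 1 + e·EI(p) > 0 for all p ∈ (0,1], satisfying the pseudo-additivity EI(p·q) = EI(p) + EI(q) + e·EI(p)·EI(q) for all p, q ∈ (0,1]. Then there exists s ∈ ℝ with s·e < 0 such that EI(p) = (p^{s} − 1)/e for all p ∈ (0,1]. -/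
open Set

/-- the pseudo-additive information content (axiom [I1]) is
`EI p = (p^s − 1)/e` with `s·e < 0`. -/
theorem pseudo_additive_information_content (e : ℝ) (he : e ≠ 0) (EI : ℝ → ℝ)
    (hc : ContinuousOn EI (Ioc (0:ℝ) 1)) (hm : StrictAntiOn EI (Ioc (0:ℝ) 1))
    (h1 : EI 1 = 0) (hpos : ∀ p ∈ Ioo (0:ℝ) 1, 0 < EI p)
    (hpos' : ∀ p ∈ Ioc (0:ℝ) 1, 0 < 1 + e * EI p)
    (hadd : ∀ p ∈ Ioc (0:ℝ) 1, ∀ q ∈ Ioc (0:ℝ) 1,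
      EI (p * q) = EI p + EI q + e * EI p * EI q) :
    ∃ s : ℝ, s * e < 0 ∧ ∀ p ∈ Ioc (0:ℝ) 1, EI p = (p ^ s - 1) / e := by
  have hmem : ∀ t : ℝ, 0 ≤ t → Real.exp (-t) ∈ Ioc (0:ℝ) 1 := fun t ht =>
    ⟨Real.exp_pos _, by rw [Real.exp_le_one_iff]; linarith⟩
  obtain ⟨g, hg⟩ : ∃ g : ℝ → ℝ, ∀ t, g t = Real.log (1 + e * EI (Real.exp (-t))) :=
    ⟨_, fun _ => rfl⟩
  have gadd : ∀ x y : ℝ, 0 ≤ x → 0 ≤ y → g (x + y) = g x + g y := by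
    intro x y hx hy
    rw [hg, hg, hg, ← Real.log_mul (hpos' _ (hmem x hx)).ne' (hpos' _ (hmem y hy)).ne',
      neg_add, Real.exp_add, hadd _ (hmem x hx) _ (hmem y hy)]
    congr 1
    ring
  have gcont : ∀ u : ℝ → ℝ, Continuous u → (∀ t, 0 ≤ u t) → Continuous fun t => g (u t) := by
    intro u hu h0
    have h2 : Continuous fun t => EI (Real.exp (-(u t))) :=
      hc.comp_continuous (by fun_prop) (fun t => hmem _ (h0 t))
    simp only [hg]
    exact Continuous.log (continuous_const.add (continuous_const.mul h2)) (fun t => (hpos' _ (hmem _ (h0 t))).ne')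
  have g0 : g 0 = 0 := by simp [hg, h1]
  let G : ℝ →+ ℝ :=
    { toFun := fun t => g (max t 0) - g (max (-t) 0)
      map_zero' := by simp
      map_add' := by
        intro x y
        have key : (max (x + y) 0 + max (-x) 0) + max (-y) 0
            = (max (-(x + y)) 0 + max x 0) + max y 0 := by
          have h : ∀ z : ℝ, max z 0 - max (-z) 0 = z := fun z => by
            rcases le_total z 0 with hz | hz
            · rw [max_eq_right hz, max_eq_left (by linarith)]; ring
            · rw [max_eq_left hz, max_eq_right (by linarith)]; ring
          linarith [h x, h y, h (x + y)]
        have k2 := congrArg g key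
        rw [gadd _ _ (by positivity) (by positivity), gadd _ _ (by positivity) (by positivity),
          gadd _ _ (by positivity) (by positivity), gadd _ _ (by positivity) (by positivity)] at k2
        linarith }
  have Gc : Continuous G :=
    (gcont (fun t => max t 0) (by fun_prop) (fun t => le_max_right _ _)).sub
      (gcont (fun t => max (-t) 0) (by fun_prop) (fun t => le_max_right _ _))
  have Glin : ∀ t, G t = t * G 1 := fun t => by
    have := map_real_smul G Gc t 1
    simpa using this
  have Gg : ∀ t, 0 ≤ t → G t = g t := fun t ht => by
    change g (max t 0) - g (max (-t) 0) = g t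
    rw [max_eq_left ht, max_eq_right (by linarith), g0, sub_zero]
  have main : ∀ p ∈ Ioc (0:ℝ) 1, 1 + e * EI p = p ^ (-(G 1)) := by
    intro p hp
    have hl : 0 ≤ -Real.log p := by linarith [Real.log_nonpos hp.1.le hp.2]
    have h3 := (Gg _ hl).symm.trans (Glin _)
    rw [hg, neg_neg, Real.exp_log hp.1] at h3
    rw [Real.rpow_def_of_pos hp.1, ← Real.exp_log (hpos' p hp), h3]
    congr 1
    ring
  refine ⟨-(G 1), ?_, fun p hp => ?_⟩
  · have hE := hpos (Real.exp (-1)) ⟨Real.exp_pos _, by rw [Real.exp_lt_one_iff]; norm_num⟩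
    have h4 := main _ (hmem 1 zero_le_one)
    rw [← Real.exp_mul] at h4
    have h5 : -1 * -(G 1) = G 1 := by ring
    rw [h5] at h4
    rcases lt_or_gt_of_ne he with h | h
    · have : Real.exp (G 1) < 1 := by nlinarith
      rw [Real.exp_lt_one_iff] at this
      nlinarith
    · have : 1 < Real.exp (G 1) := by nlinarith
      rw [Real.one_lt_exp_iff] at this
      nlinarith
  · rw [← main p hp]
    field_simp
    ring
end

section
/- Let e > 0 and let CC : (0,1] → (0,∞) be continuous and strictly increasing, satisfying CC(p·q) = e·CC(p)·CC(q) for all p, q ∈ (0,1]. Then there exists s > 0 such that CC(p) = p^{s}/e for all p ∈ (0,1]. -/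
open Set

/-- the multiplicative certainty content (axiom [C1]) is
`CC p = p^s / e` with `s > 0`. -/
theorem multiplicative_certainty_content (e : ℝ) (he : 0 < e) (CC : ℝ → ℝ)
    (hc : ContinuousOn CC (Ioc (0:ℝ) 1)) (hm : StrictMonoOn CC (Ioc (0:ℝ) 1))
    (hpos : ∀ p ∈ Ioc (0:ℝ) 1, 0 < CC p)
    (hmul : ∀ p ∈ Ioc (0:ℝ) 1, ∀ q ∈ Ioc (0:ℝ) 1,
      CC (p * q) = e * CC p * CC q) :
    ∃ s : ℝ, 0 < s ∧ ∀ p ∈ Ioc (0:ℝ) 1, CC p = p ^ s / e := by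
  have hmem : ∀ t : ℝ, 0 ≤ t → Real.exp (-t) ∈ Ioc (0:ℝ) 1 := fun t ht =>
    ⟨Real.exp_pos _, Real.exp_le_one_iff.2 (by linarith)⟩
  obtain ⟨g, hg⟩ : ∃ g : ℝ → ℝ, g = fun t => Real.log (e * CC (Real.exp (-t))) := ⟨_, rfl⟩
  have hadd : ∀ a b : ℝ, 0 ≤ a → 0 ≤ b → g (a + b) = g a + g b := by
    intro a b ha hb
    have h1 := mul_pos he (hpos _ (hmem a ha))
    have h2 := mul_pos he (hpos _ (hmem b hb))
    simp only [hg]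
    rw [← Real.log_mul h1.ne' h2.ne', neg_add, Real.exp_add,
      hmul _ (hmem a ha) _ (hmem b hb)]
    congr 1
    ring
  have hg0 : g 0 = 0 := by
    have := hadd 0 0 le_rfl le_rfl
    simp only [add_zero] at this
    linarith
  have hmax : ∀ f : ℝ → ℝ, Continuous f → Continuous fun x => g (max (f x) 0) := by
    intro f hf
    simp only [hg]
    have h1 : Continuous fun x => CC (Real.exp (-(max (f x) 0))) :=
      hc.comp_continuous (by fun_prop) (fun x => hmem _ (le_max_right _ _))
    exact (continuous_const.mul h1).log
      (fun x => (mul_pos he (hpos _ (hmem _ (le_max_right _ _)))).ne')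
  have hsplit : ∀ x : ℝ, max x 0 - max (-x) 0 = x := by
    intro x
    rcases le_total x 0 with h | h
    · rw [max_eq_right h, max_eq_left (by linarith)]; ring
    · rw [max_eq_left h, max_eq_right (by linarith)]; ring
  let G : ℝ →+ ℝ :=
    { toFun := fun x => g (max x 0) - g (max (-x) 0)
      map_zero' := by simp
      map_add' := by
        intro x y
        have p1 := le_max_right x 0
        have p2 := le_max_right (-x) 0
        have p3 := le_max_right y 0
        have p4 := le_max_right (-y) 0
        have p5 := le_max_right (x + y) 0
        have p6 := le_max_right (-(x + y)) 0
        have q1 := hadd _ _ (add_nonneg p1 p3) p6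
        have q2 := hadd _ _ (add_nonneg p2 p4) p5
        rw [hadd _ _ p1 p3] at q1
        rw [hadd _ _ p2 p4] at q2
        have e1 : max x 0 + max y 0 + max (-(x + y)) 0
            = max (-x) 0 + max (-y) 0 + max (x + y) 0 := by
          linarith [hsplit x, hsplit y, hsplit (x + y)]
        rw [e1] at q1
        linarith }
  have hGc : Continuous G := (hmax _ continuous_id).sub (hmax _ continuous_neg)
  have hGg : ∀ t : ℝ, 0 ≤ t → G t = g t := by
    intro t ht
    change g (max t 0) - g (max (-t) 0) = g t
    rw [max_eq_left ht, max_eq_right (by linarith), hg0, sub_zero]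
  have hlin : ∀ t : ℝ, 0 ≤ t → g t = t * g 1 := by
    intro t ht
    have := map_real_smul G hGc t 1
    simp only [smul_eq_mul, mul_one] at this
    rwa [hGg t ht, hGg 1 zero_le_one] at this
  refine ⟨-g 1, ?_, ?_⟩
  · have h1 : CC (Real.exp (-1)) < CC (Real.exp (-0)) :=
      hm (hmem 1 zero_le_one) (hmem 0 le_rfl) (Real.exp_lt_exp.2 (by norm_num))
    have h2 : g 1 < g 0 := by
      simp only [hg]
      exact Real.log_lt_log (mul_pos he (hpos _ (hmem 1 zero_le_one)))
        (mul_lt_mul_of_pos_left h1 he)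
    linarith
  · intro p hp
    have h := hlin (-Real.log p) (by linarith [Real.log_nonpos hp.1.le hp.2])
    have h3 : g (-Real.log p) = Real.log (e * CC p) := by
      simp only [hg, neg_neg, Real.exp_log hp.1]
    rw [h3] at h
    rw [eq_div_iff he.ne', Real.rpow_def_of_pos hp.1, mul_comm,
      ← Real.exp_log (mul_pos he (hpos p hp)), h]
    congr 1
    ring
end

section
/- Fix e ≠ 0, τ < 0, c with c·e > 0, and a continuous strictly monotone function f defined on [0,∞). Let EI : (0,1] → ℝ be continuous, strictly decreasing, with EI(1) = 0, EI(p) > 0 and 1 + e·EI(p) > 0 for p ∈ (0,1), satisfying EI(pq) = EI(p) + EI(q) + e·EI(p)·EI(q) for all p, q. For each n ≥ 1, U ∈ Δ_n, P ∈ Δ_n⁺ define I(U; P) = f⁻¹( Σ_{k=1}^n u_k·f(EI(p_k)) ), and assume I(U⋆V; P⋆Q) = I(U; P) + I(V; Q) + e·I(U; P)·I(V; Q) for all n, m, U ∈ Δ_n, V ∈ Δ_m, P ∈ Δ_n⁺, Q ∈ Δ_m⁺. Then there exist τ < 0 and c with c·e > 0 such that either I(U; P) = (1/e)·( 2^{ c·τ·Σ_k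 u_k·log₂ p_k } − 1 ) for all n, U, P, or there exists λ ≠ 0 with I(U; P) = (1/e)·( ( Σ_k u_k·p_k^{τλ} )^{c/λ} − 1 ) for all n, U, P. -/
open Set

lemma additive_nonneg (L : ℝ → ℝ) (hc : ContinuousOn L (Ici 0))
    (ha : ∀ x y, 0 ≤ x → 0 ≤ y → L (x + y) = L x + L y) :
    ∀ x, 0 ≤ x → L x = L 1 * x := by
  have h0 : L 0 = 0 := by
    have := ha 0 0 le_rfl le_rfl
    simp at this
    exact this
  let F : ℝ → ℝ := fun x => L (max x 0) - L (max (-x) 0)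
  have key : ∀ a b, 0 ≤ a → 0 ≤ b → F (a - b) = L a - L b := by
    intro a b h1 h2
    have e1 := ha a (max (-(a - b)) 0) h1 (le_max_right _ _)
    have e2 := ha b (max (a - b) 0) h2 (le_max_right _ _)
    have e3 : a + max (-(a - b)) 0 = b + max (a - b) 0 := by
      rcases le_total (a - b) 0 with h | h
      · rw [max_eq_left (by linarith), max_eq_right h]; ring
      · rw [max_eq_right (by linarith), max_eq_left h]; ring
    rw [e3] at e1
    simp only [F]
    linarith
  have split : ∀ x : ℝ, x = max x 0 - max (-x) 0 := by
    intro x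
    rcases le_total x 0 with h | h
    · rw [max_eq_right h, max_eq_left (by linarith)]; ring
    · rw [max_eq_left h, max_eq_right (by linarith)]; ring
  have Fadd : ∀ x y, F (x + y) = F x + F y := by
    intro x y
    have : x + y = (max x 0 + max y 0) - (max (-x) 0 + max (-y) 0) := by
      have := split x; have := split y; linarith
    rw [this, key _ _ (by positivity) (by positivity), ha _ _ (by positivity) (by positivity),
      ha _ _ (by positivity) (by positivity)]
    simp only [F]; ring
  have Fc : Continuous F := by
    apply Continuous.sub
    · exact hc.comp_continuous (by fun_prop) (fun x => mem_Ici.2 (le_max_right _ _))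
    · exact hc.comp_continuous (by fun_prop) (fun x => mem_Ici.2 (le_max_right _ _))
  have FL : ∀ x, 0 ≤ x → F x = L x := by
    intro x hx
    have := key x 0 hx le_rfl
    simpa [h0] using this
  intro x hx
  let G : ℝ →+ ℝ := AddMonoidHom.mk' F Fadd
  have := map_real_smul G Fc x 1
  simp only [smul_eq_mul, mul_one] at this
  have h2 : F x = x * F 1 := this
  rw [FL x hx, FL 1 zero_le_one] at h2
  linarith

lemma mult_nonneg (G : ℝ → ℝ) (hc : ContinuousOn G (Ici 0)) (hp : ∀ x, 0 ≤ x → 0 < G x)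
    (ha : ∀ x y, 0 ≤ x → 0 ≤ y → G (x + y) = G x * G y) :
    ∃ b : ℝ, ∀ x, 0 ≤ x → G x = Real.exp (b * x) := by
  refine ⟨Real.log (G 1), fun x hx => ?_⟩
  have := additive_nonneg (fun x => Real.log (G x))
    (hc.log (fun x hx => (hp x hx).ne')) (fun x y hx hy => by
      simp only [ha x y hx hy]
      exact Real.log_mul (hp x hx).ne' (hp y hy).ne') x hx

  rw [← this, Real.exp_log (hp x hx)]

lemma pseudo_solve (H : ℝ → ℝ) (k : ℝ) (hc : ContinuousOn H (Ici 0))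
    (hm : ∀ x, 0 < x → 0 < H x) (h0 : H 0 = 0)
    (ha : ∀ x y, 0 ≤ x → 0 ≤ y → H (x + y) = H x + H y + k * H x * H y) :
    (∃ b : ℝ, b ≠ 0 ∧ ∀ x, 0 ≤ x → H x = b * x) ∨
    (∃ b β : ℝ, b ≠ 0 ∧ β ≠ 0 ∧ ∀ x, 0 ≤ x → H x = β * (Real.exp (b * x) - 1)) := by
  by_cases hk : k = 0
  · left
    refine ⟨H 1, (hm 1 one_pos).ne', additive_nonneg H hc ?_⟩
    intro x y hx hy
    rw [ha x y hx hy, hk]; ring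
  · right
    let G : ℝ → ℝ := fun x => 1 + k * H x
    have hG : ∀ x y, 0 ≤ x → 0 ≤ y → G (x + y) = G x * G y := by
      intro x y hx hy
      simp only [G]; rw [ha x y hx hy]; ring
    have hGc : ContinuousOn G (Ici 0) := by
      simp only [G]; fun_prop
    have hGnn : ∀ x, 0 ≤ x → 0 ≤ G x := by
      intro x hx
      have := hG (x/2) (x/2) (by positivity) (by positivity)
      rw [add_halves] at this
      rw [this]; exact mul_self_nonneg _
    have hGne : ∀ x, 0 ≤ x → G x ≠ 0 := by
      -- a zero at x gives zeros at x + 1, so H agrees there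
      intro x hx hz
      have h1 := hG x 1 hx zero_le_one
      rw [hz, zero_mul] at h1
      have h2 := hG 1 x zero_le_one hx
      -- use halving towards 0
      have hpow : ∀ n : ℕ, G (x / 2 ^ n) = 0 := by
        intro n
        induction n with
        | zero => simpa using hz
        | succ n ih =>
          have := hG (x / 2 ^ (n+1)) (x / 2 ^ (n+1)) (by positivity) (by positivity)
          have e : x / 2 ^ (n+1) + x / 2 ^ (n+1) = x / 2 ^ n := by
            field_simp; ring
          rw [e, ih] at this
          exact mul_self_eq_zero.mp this.symm
      have hlim : Filter.Tendsto (fun n : ℕ => x / 2 ^ n) Filter.atTop (nhdsWithin 0 (Ici 0)) := by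
        apply tendsto_nhdsWithin_of_tendsto_nhds_of_eventually_within
        · have := (tendsto_pow_atTop_nhds_zero_of_lt_one (r := (1/2 : ℝ)) (by norm_num)
            (by norm_num)).const_mul x
          simp only [mul_zero] at this
          refine this.congr (fun n => ?_)
          rw [div_pow, one_pow]; ring
        · exact Filter.Eventually.of_forall (fun n => by
            show 0 ≤ x / 2 ^ n
            positivity)
      have hl := (hGc 0 (by simp)).tendsto.comp hlim
      have hl2 : Filter.Tendsto (G ∘ fun n : ℕ => x / 2 ^ n) Filter.atTop (nhds 0) := by
        refine tendsto_const_nhds.congr (fun n => ?_)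
        exact (hpow n).symm
      have := tendsto_nhds_unique hl hl2
      simp [G, h0] at this
    obtain ⟨b, hb⟩ := mult_nonneg G hGc
      (fun x hx => lt_of_le_of_ne (hGnn x hx) (hGne x hx).symm) hG
    have hHb : ∀ x, 0 ≤ x → H x = k⁻¹ * (Real.exp (b * x) - 1) := by
      intro x hx
      rw [← hb x hx]; simp only [G]; field_simp; ring
    refine ⟨b, k⁻¹, ?_, inv_ne_zero hk, hHb⟩
    rintro rfl
    have := hHb 1 zero_le_one
    have := hm 1 one_pos
    simp at *
    linarith

lemma shift_solve_mono (h : ℝ → ℝ) (hc : ContinuousOn h (Ici 0)) (hm : StrictMonoOn h (Ici 0))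
    (hs : ∀ s x₁ x₂ u t : ℝ, 0 < s → 0 < x₁ → 0 < x₂ → Real.exp (-x₁) + Real.exp (-x₂) < 1 →
      0 ≤ u → u ≤ 1 → 0 ≤ t → h t = u * h x₁ + (1 - u) * h x₂ →
      h (t + s) = u * h (x₁ + s) + (1 - u) * h (x₂ + s)) :
    (∃ b : ℝ, b ≠ 0 ∧ ∀ x, 0 ≤ x → h x = h 0 + b * x) ∨
    (∃ b β : ℝ, b ≠ 0 ∧ β ≠ 0 ∧ ∀ x, 0 ≤ x → h x = h 0 + β * (Real.exp (b * x) - 1)) := by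
  -- one step
  have step : ∀ s x X : ℝ, 0 < s → 0 < x → x < X → Real.exp (-x) + Real.exp (-X) < 1 →
      ∃ A : ℝ, ∀ y, x ≤ y → y ≤ X → h (y + s) - h (x + s) = A * (h y - h x) := by
    intro s x X hs0 hx hxX hexp
    have hd : 0 < h X - h x := sub_pos.mpr (hm (mem_Ici.2 hx.le) (mem_Ici.2 (hx.trans hxX).le) hxX)
    refine ⟨(h (X + s) - h (x + s)) / (h X - h x), fun y hy hyX => ?_⟩
    have h1 : h x ≤ h y := hm.monotoneOn (mem_Ici.2 hx.le) (mem_Ici.2 (hx.le.trans hy)) hy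
    have h2 : h y ≤ h X := hm.monotoneOn (mem_Ici.2 (hx.le.trans hy))
      (mem_Ici.2 (hx.trans hxX).le) hyX
    have := hs s x X ((h X - h y) / (h X - h x)) y hs0 hx (hx.trans hxX) hexp
      (div_nonneg (by linarith) hd.le) ((div_le_one hd).2 (by linarith)) (hx.le.trans hy)
      (by field_simp; ring)
    rw [this]; field_simp; ring
  have stepA : ∀ s : ℝ, 0 < s → ∃ A : ℝ, ∀ x y, 0 < x → 0 < y →
      h (y + s) - h (x + s) = A * (h y - h x) := by
    intro s hs0
    have h23 : 0 < h 3 - h 2 := sub_pos.mpr (hm (by simp) (by simp) (by norm_num))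
    have main : ∀ x, 0 < x → x ≤ 2 → ∀ y, x ≤ y → h (y + s) - h (x + s) =
        (h (3 + s) - h (2 + s)) / (h 3 - h 2) * (h y - h x) := by
      intro x hx hx2 y hy
      have hl : Filter.Tendsto (fun X : ℝ => Real.exp (-x) + Real.exp (-X)) Filter.atTop
          (nhds (Real.exp (-x) + 0)) :=
        tendsto_const_nhds.add (Real.tendsto_exp_neg_atTop_nhds_zero)
      have hlt : Real.exp (-x) + 0 < 1 := by
        rw [add_zero, Real.exp_lt_one_iff]; linarith
      obtain ⟨X, hX1, hX2, hX3⟩ := ((hl.eventually (gt_mem_nhds hlt)).and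
        ((Filter.eventually_ge_atTop y).and (Filter.eventually_ge_atTop (3:ℝ)))).exists
      obtain ⟨A, hA⟩ := step s x X hs0 hx (by linarith) hX1
      have a2 := hA 2 hx2 (by linarith)
      have a3 := hA 3 (by linarith) hX3
      have : (h (3 + s) - h (2 + s)) / (h 3 - h 2) = A := by
        rw [div_eq_iff h23.ne']; linarith
      rw [this, hA y hy hX2]
    refine ⟨(h (3 + s) - h (2 + s)) / (h 3 - h 2), fun x y hx hy => ?_⟩
    have hz : 0 < min (min x y) 2 := by positivity
    have e1 := main _ hz (min_le_right _ _) x ((min_le_left _ _).trans (min_le_left _ _))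
    have e2 := main _ hz (min_le_right _ _) y ((min_le_left _ _).trans (min_le_right _ _))
    linarith
  have stepB : ∀ s : ℝ, ∃ A : ℝ, 0 ≤ s → ∀ y, 0 ≤ y → h (y + s) - h s = A * (h y - h 0) := by
    intro s
    rcases lt_or_ge 0 s with hs0 | hs0
    · obtain ⟨A, hA⟩ := stepA s hs0
      refine ⟨A, fun _ y hy => ?_⟩
      rcases hy.eq_or_lt with rfl | hy
      · simp
      have l1 : Filter.Tendsto h (nhdsWithin 0 (Ioi 0)) (nhds (h 0)) :=
        (hc 0 (by simp)).mono_left (nhdsWithin_mono _ Ioi_subset_Ici_self)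
      have l2 : Filter.Tendsto (fun x => h (x + s)) (nhdsWithin 0 (Ioi 0)) (nhds (h (0 + s))) := by
        have : ContinuousOn (fun x => h (x + s)) (Ici 0) :=
          hc.comp (by fun_prop) (fun x hx => by simp only [mem_Ici] at *; linarith)
        exact (this 0 (by simp)).mono_left (nhdsWithin_mono _ Ioi_subset_Ici_self)
      have l3 : Filter.Tendsto (fun x => h (y + s) - h (x + s)) (nhdsWithin 0 (Ioi 0))
          (nhds (h (y + s) - h (0 + s))) := tendsto_const_nhds.sub l2
      have l4 : Filter.Tendsto (fun x => A * (h y - h x)) (nhdsWithin 0 (Ioi 0))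
          (nhds (A * (h y - h 0))) := tendsto_const_nhds.mul (tendsto_const_nhds.sub l1)
      have l5 : Filter.Tendsto (fun x => h (y + s) - h (x + s)) (nhdsWithin 0 (Ioi 0))
          (nhds (A * (h y - h 0))) := by
        refine l4.congr' ?_
        filter_upwards [self_mem_nhdsWithin] with x hx
        exact (hA x y hx hy).symm
      have := tendsto_nhds_unique l3 l5
      simpa using this
    · refine ⟨1, fun h0 y hy => ?_⟩
      have : s = 0 := le_antisymm hs0 h0
      subst this; simp
  choose A hA using stepB
  have hpos : ∀ x, 0 < x → 0 < h x - h 0 := fun x hx =>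
    sub_pos.mpr (hm (by simp) (mem_Ici.2 hx.le) hx)
  have hk : ∀ s, 0 < s → A s - 1 = (A 1 - 1) / (h 1 - h 0) * (h s - h 0) := by
    intro s hs0
    have e1 := hA s hs0.le 1 zero_le_one
    have e2 := hA 1 zero_le_one s hs0.le
    rw [add_comm] at e1
    have := hpos 1 one_pos
    field_simp
    linarith
  have := pseudo_solve (fun x => h x - h 0) ((A 1 - 1) / (h 1 - h 0)) (by fun_prop) hpos (by simp)
    (by
      intro x y hx hy
      rcases hx.eq_or_lt with rfl | hx
      · simp
      have e1 := hA x hx.le y hy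
      have e2 := hk x hx
      have e3 : A x = 1 + (A 1 - 1) / (h 1 - h 0) * (h x - h 0) := by linarith
      rw [e3] at e1
      rw [add_comm x y]

      linarith)
  rcases this with ⟨b, hb, H⟩ | ⟨b, β, hb, hβ, H⟩
  · exact Or.inl ⟨b, hb, fun x hx => by linarith [H x hx]⟩
  · exact Or.inr ⟨b, β, hb, hβ, fun x hx => by linarith [H x hx]⟩

lemma shift_solve (h : ℝ → ℝ) (hc : ContinuousOn h (Ici 0))
    (hm : StrictMonoOn h (Ici 0) ∨ StrictAntiOn h (Ici 0))
    (hs : ∀ s x₁ x₂ u t : ℝ, 0 < s → 0 < x₁ → 0 < x₂ → Real.exp (-x₁) + Real.exp (-x₂) < 1 →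
      0 ≤ u → u ≤ 1 → 0 ≤ t → h t = u * h x₁ + (1 - u) * h x₂ →
      h (t + s) = u * h (x₁ + s) + (1 - u) * h (x₂ + s)) :
    (∃ b : ℝ, b ≠ 0 ∧ ∀ x, 0 ≤ x → h x = h 0 + b * x) ∨
    (∃ b β : ℝ, b ≠ 0 ∧ β ≠ 0 ∧ ∀ x, 0 ≤ x → h x = h 0 + β * (Real.exp (b * x) - 1)) := by
  rcases hm with hm | hm
  · exact shift_solve_mono h hc hm hs
  · have := shift_solve_mono (fun x => - h x) hc.neg hm.neg
      (fun s x₁ x₂ u t a1 a2 a3 a4 a5 a6 a7 a8 => by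
        have := hs s x₁ x₂ u t a1 a2 a3 a4 a5 a6 a7 (by linarith)
        linarith)
    rcases this with ⟨b, hb, H⟩ | ⟨b, β, hb, hβ, H⟩
    · exact Or.inl ⟨-b, neg_ne_zero.2 hb, fun x hx => by linarith [H x hx]⟩
    · exact Or.inr ⟨b, -β, hb, neg_ne_zero.2 hβ, fun x hx => by linarith [H x hx]⟩

lemma sum_prodDist {n m : ℕ} (U P : Fin n → ℝ) (V Q : Fin m → ℝ) (g : ℝ → ℝ) :
    ∑ i, prodDist U V i * g (prodDist P Q i) = ∑ k, ∑ l, U k * V l * g (P k * Q l) := by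
  rw [← Fintype.sum_prod_type' (fun k l => U k * V l * g (P k * Q l))]
  simp only [prodDist]
  exact Equiv.sum_comp finProdFinEquiv.symm (fun x : Fin n × Fin m => U x.1 * V x.2 * g (P x.1 * Q x.2))

/-- characterization of pseudo-additive (e ≠ 0) polynomially composable
inaccuracy measures (axioms [I1]–[I3]), equation (26) of the paper. -/
theorem pseudo_additive_inaccuracy_characterization
    (e τ c : ℝ) (he : e ≠ 0) (hτ : τ < 0) (hce : 0 < c * e)
    (f finv : ℝ → ℝ)
    (hfc : ContinuousOn f (Ici (0:ℝ)))
    (hfm : StrictMonoOn f (Ici (0:ℝ)) ∨ StrictAntiOn f (Ici (0:ℝ)))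
    (hfi : ∀ x ∈ Ici (0:ℝ), finv (f x) = x)
    (EI : ℝ → ℝ)
    (hEIc : ContinuousOn EI (Ioc (0:ℝ) 1)) (hEIm : StrictAntiOn EI (Ioc (0:ℝ) 1))
    (hEI1 : EI 1 = 0)
    (hEIpos : ∀ p ∈ Ioo (0:ℝ) 1, 0 < EI p)
    (hEIpos' : ∀ p ∈ Ioo (0:ℝ) 1, 0 < 1 + e * EI p)
    (hEIadd : ∀ p ∈ Ioc (0:ℝ) 1, ∀ q ∈ Ioc (0:ℝ) 1,
      EI (p * q) = EI p + EI q + e * EI p * EI q)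
    (I : ∀ n : ℕ, (Fin n → ℝ) → (Fin n → ℝ) → ℝ)
    (hIdef : ∀ (n : ℕ) (U P : Fin n → ℝ),
      I n U P = finv (∑ k, U k * f (EI (P k))))
    (hadd : ∀ (n m : ℕ) (U : Fin n → ℝ) (V : Fin m → ℝ) (P : Fin n → ℝ)
      (Q : Fin m → ℝ), IsDist U → IsDist V → IsPosDist P → IsPosDist Q →
      I (n * m) (prodDist U V) (prodDist P Q) =
        I n U P + I m V Q + e * I n U P * I m V Q) :
    ∃ τ' : ℝ, τ' < 0 ∧ ∃ c' : ℝ, 0 < c' * e ∧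
      ((∀ (n : ℕ) (U P : Fin n → ℝ), IsDist U → IsPosDist P →
        I n U P =
          (1 / e) * ((2:ℝ) ^ (c' * τ' * ∑ k, U k * Real.logb 2 (P k)) - 1)) ∨
      (∃ lam : ℝ, lam ≠ 0 ∧ ∀ (n : ℕ) (U P : Fin n → ℝ), IsDist U → IsPosDist P →
        I n U P =
          (1 / e) * ((∑ k, U k * P k ^ (τ' * lam)) ^ (c' / lam) - 1))) := by
  have hexpmem : ∀ t : ℝ, 0 ≤ t → Real.exp (-t) ∈ Ioc (0:ℝ) 1 := fun t ht =>
    ⟨Real.exp_pos _, Real.exp_le_one_iff.2 (by linarith)⟩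
  have hEI0 : ∀ p ∈ Ioc (0:ℝ) 1, 0 ≤ EI p := by
    intro p hp
    rcases hp.2.eq_or_lt with h | h
    · rw [h, hEI1]
    · exact (hEIpos p ⟨hp.1, h⟩).le
  let E : ℝ → ℝ := fun t => EI (Real.exp (-t))
  have hEmaps : MapsTo (fun t : ℝ => Real.exp (-t)) (Ici 0) (Ioc (0:ℝ) 1) :=
    fun t ht => hexpmem t ht
  have hEc : ContinuousOn E (Ici 0) := hEIc.comp (by fun_prop) hEmaps
  have hEm : StrictMonoOn E (Ici 0) := by
    intro x hx y hy hxy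
    exact hEIm (hEmaps hy) (hEmaps hx) (Real.exp_lt_exp.2 (by linarith))
  have hEnn : MapsTo E (Ici 0) (Ici 0) := fun t ht => hEI0 _ (hEmaps ht)
  let h : ℝ → ℝ := fun t => f (E t)
  have hhc : ContinuousOn h (Ici 0) := hfc.comp hEc hEnn
  have hhm : StrictMonoOn h (Ici 0) ∨ StrictAntiOn h (Ici 0) := by
    rcases hfm with hf | hf
    · left
      intro x hx y hy hxy
      exact hf (hEnn hx) (hEnn hy) (hEm hx hy hxy)
    · right
      intro x hx y hy hxy
      exact hf (hEnn hx) (hEnn hy) (hEm hx hy hxy)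
  have hfinv : ∀ t, 0 ≤ t → finv (h t) = E t := fun t ht => hfi _ (hEnn ht)
  have hconv : Convex ℝ (h '' Ici 0) := by
    have := (isPreconnected_Ici (a := (0:ℝ))).image h hhc
    exact this.ordConnected.convex
  have hP1 : ∀ (n : ℕ) (P : Fin n → ℝ), IsPosDist P → ∀ k, P k ∈ Ioc (0:ℝ) 1 := by
    intro n P hP k
    refine ⟨hP.1 k, ?_⟩
    rw [← hP.2]
    exact Finset.single_le_sum (fun i _ => (hP.1 i).le) (Finset.mem_univ k)
  have hmean : ∀ (n : ℕ) (U P : Fin n → ℝ), IsDist U → (∀ k, P k ∈ Ioc (0:ℝ) 1) →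
      ∃ t, 0 ≤ t ∧ h t = ∑ k, U k * f (EI (P k)) := by
    intro n U P hU hP
    have : ∑ k, U k • f (EI (P k)) ∈ h '' Ici 0 := by
      refine hconv.sum_mem (fun i _ => hU.1 i) hU.2 (fun i _ => ?_)
      refine ⟨-Real.log (P i), ?_, ?_⟩
      · have := Real.log_nonpos (hP i).1.le (hP i).2
        simp only [mem_Ici]; linarith
      · simp only [h, E, neg_neg, Real.exp_log (hP i).1]
    obtain ⟨t, ht, hte⟩ := this
    exact ⟨t, ht, by simpa using hte⟩
  have hIE : ∀ (n : ℕ) (U P : Fin n → ℝ) (t : ℝ), 0 ≤ t → h t = ∑ k, U k * f (EI (P k)) →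
      I n U P = E t := by
    intro n U P t ht hte
    rw [hIdef, ← hte, hfinv t ht]
  have hEadd : ∀ x y, 0 ≤ x → 0 ≤ y → E (x + y) = E x + E y + e * E x * E y := by
    intro x y hx hy
    have := hEIadd _ (hexpmem x hx) _ (hexpmem y hy)
    rw [← Real.exp_add, ← neg_add] at this
    exact this
  have hprod : ∀ {n m : ℕ} (U : Fin n → ℝ) (V : Fin m → ℝ), IsDist U → IsDist V →
      IsDist (prodDist U V) := by
    intro n m U V hU hV
    refine ⟨fun i => mul_nonneg (hU.1 _) (hV.1 _), ?_⟩
    have := sum_prodDist U U V V (fun _ => 1)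
    simp only [mul_one] at this
    rw [this, ← Fintype.sum_mul_sum, hU.2, hV.2, mul_one]
  have hshift : ∀ s x₁ x₂ u t : ℝ, 0 < s → 0 < x₁ → 0 < x₂ →
      Real.exp (-x₁) + Real.exp (-x₂) < 1 →
      0 ≤ u → u ≤ 1 → 0 ≤ t → h t = u * h x₁ + (1 - u) * h x₂ →
      h (t + s) = u * h (x₁ + s) + (1 - u) * h (x₂ + s) := by
    intro s x₁ x₂ u t hs hx₁ hx₂ hexp hu0 hu1 ht hte
    let U : Fin 3 → ℝ := ![u, 1 - u, 0]
    let P : Fin 3 → ℝ := ![Real.exp (-x₁), Real.exp (-x₂), 1 - Real.exp (-x₁) - Real.exp (-x₂)]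
    let V : Fin 2 → ℝ := ![1, 0]
    let Q : Fin 2 → ℝ := ![Real.exp (-s), 1 - Real.exp (-s)]
    have hs1 : Real.exp (-s) < 1 := Real.exp_lt_one_iff.2 (by linarith)
    have hU : IsDist U := by
      refine ⟨fun i => ?_, ?_⟩
      · fin_cases i <;> simp [U, hu0, hu1]
      · simp [U, Fin.sum_univ_three]
    have hP : IsPosDist P := by
      refine ⟨fun i => ?_, ?_⟩
      · fin_cases i <;> simp [P, Real.exp_pos]
        linarith
      · simp [P, Fin.sum_univ_three]
    have hV : IsDist V := by
      refine ⟨fun i => ?_, ?_⟩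
      · fin_cases i <;> simp [V]
      · simp [V]
    have hQ : IsPosDist Q := by
      refine ⟨fun i => ?_, ?_⟩
      · fin_cases i <;> simp [Q, Real.exp_pos, hs]
      · simp [Q]
    have i1 : I 3 U P = E t := hIE _ _ _ t ht (by
      rw [hte]; simp [U, P, Fin.sum_univ_three, h, E])
    have i2 : I 2 V Q = E s := hIE _ _ _ s hs.le (by
      simp [V, Q, h, E])
    have hPQ : ∀ k, prodDist P Q k ∈ Ioc (0:ℝ) 1 := by
      intro k
      have a := hP1 _ P hP (finProdFinEquiv.symm k).1
      have b := hP1 _ Q hQ (finProdFinEquiv.symm k).2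
      exact ⟨mul_pos a.1 b.1, mul_le_one₀ a.2 b.1.le b.2⟩
    obtain ⟨t', ht', hte'⟩ := hmean _ _ _ (hprod U V hU hV) hPQ
    have i3 := hIE _ _ _ t' ht' hte'
    have := hadd 3 2 U V P Q hU hV hP hQ
    rw [i1, i2, i3, ← hEadd t s ht hs.le] at this
    have htt : t' = t + s := hEm.injOn ht' (mem_Ici.2 (by linarith)) this
    rw [← htt, hte', sum_prodDist U P V Q (fun p => f (EI p))]
    simp [U, V, P, Q, h, E, Fin.sum_univ_three, ← Real.exp_add, add_comm]
  have hE0 : E 0 = 0 := by simp [E, hEI1]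
  obtain ⟨a, ha⟩ := mult_nonneg (fun t => 1 + e * E t) (by fun_prop)
    (by
      intro x hx
      rcases hx.eq_or_lt with rfl | hx
      · simp [hE0]
      · exact hEIpos' _ ⟨Real.exp_pos _, Real.exp_lt_one_iff.2 (by linarith)⟩)
    (by
      intro x y hx hy
      simp only [hEadd x y hx hy]; ring)
  have hae : 0 < a * e := by
    have h1 := ha 1 zero_le_one
    have hE1 : 0 < E 1 := by
      rw [← hE0]; exact hEm (by simp) (by simp) one_pos
    rw [mul_one] at h1
    rcases lt_or_gt_of_ne he with h' | h'
    · have : Real.exp a < 1 := by nlinarith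
      rw [Real.exp_lt_one_iff] at this
      exact mul_pos_of_neg_of_neg this h'
    · have : 1 < Real.exp a := by nlinarith
      rw [Real.one_lt_exp_iff] at this
      exact mul_pos this h'
  have hEa : ∀ t, 0 ≤ t → E t = (1 / e) * (Real.exp (a * t) - 1) := by
    intro t ht
    rw [← ha t ht]; field_simp; ring
  have hterm : ∀ p ∈ Ioc (0:ℝ) 1, f (EI p) = h (-Real.log p) := by
    intro p hp
    simp only [h, E, neg_neg, Real.exp_log hp.1]
  have hlog : ∀ p ∈ Ioc (0:ℝ) 1, 0 ≤ -Real.log p := by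
    intro p hp
    have := Real.log_nonpos hp.1.le hp.2
    linarith
  refine ⟨-1, by norm_num, a, hae, ?_⟩
  rcases shift_solve h hhc hhm hshift with ⟨b, hb, H⟩ | ⟨b, β, hb, hβ, H⟩
  · left
    intro n U P hU hP
    have hP' := hP1 n P hP
    obtain ⟨t, ht, hte⟩ := hmean n U P hU hP'
    rw [hIE n U P t ht hte, hEa t ht]
    have e1 : ∑ k, U k * f (EI (P k)) = h 0 + b * ∑ k, U k * (-Real.log (P k)) := by
      rw [Finset.mul_sum, ← one_mul (h 0), ← hU.2, Finset.sum_mul, ← Finset.sum_add_distrib]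
      refine Finset.sum_congr rfl (fun k _ => ?_)
      rw [hterm _ (hP' k), H _ (hlog _ (hP' k))]; ring
    rw [e1, H t ht] at hte
    have e2 : t = ∑ k, U k * (-Real.log (P k)) := mul_left_cancel₀ hb (by linarith)
    have e3 : ∑ k, U k * Real.logb 2 (P k) = -t / Real.log 2 := by
      rw [e2, ← Finset.sum_neg_distrib, Finset.sum_div]
      refine Finset.sum_congr rfl (fun k _ => ?_)
      rw [Real.logb]; ring
    rw [e3, Real.rpow_def_of_pos (by norm_num)]
    have : Real.log 2 ≠ 0 := (Real.log_pos (by norm_num)).ne'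
    congr 3
    field_simp
  · right
    refine ⟨b, hb, ?_⟩
    intro n U P hU hP
    have hP' := hP1 n P hP
    obtain ⟨t, ht, hte⟩ := hmean n U P hU hP'
    rw [hIE n U P t ht hte, hEa t ht]
    have e1 : ∑ k, U k * f (EI (P k)) = h 0 - β + β * ∑ k, U k * P k ^ (-1 * b) := by
      rw [Finset.mul_sum, ← one_mul (h 0 - β), ← hU.2, Finset.sum_mul, ← Finset.sum_add_distrib]
      refine Finset.sum_congr rfl (fun k _ => ?_)
      rw [hterm _ (hP' k), H _ (hlog _ (hP' k)), Real.rpow_def_of_pos (hP' k).1]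
      have : b * -Real.log (P k) = Real.log (P k) * (-1 * b) := by ring
      rw [hU.2, this]; ring
    rw [e1, H t ht] at hte
    have e2 : Real.exp (b * t) = ∑ k, U k * P k ^ (-1 * b) := mul_left_cancel₀ hβ (by linarith)
    rw [← e2, ← Real.exp_mul]
    congr 3
    field_simp
end

section
/- Fix τ < 0 and a continuous strictly monotone function f on [0,∞). Let EI : (0,1] → ℝ be continuous strictly decreasing with EI(pq) = EI(p) + EI(q) for all p, q ∈ (0,1] and EI(p) > 0 for p ∈ (0,1). For each n ≥ 1, U ∈ Δ_n, P ∈ Δ_n⁺ define I(U; P) = f⁻¹( Σ_{k=1}^n u_k·f(EI(p_k)) ), and assume I(U⋆V; P⋆Q) = I(U; P) + I(V; Q) for all n, m, U ∈ Δ_n, V ∈ Δ_m, P ∈ Δ_n⁺, Q ∈ Δ_m⁺. Then there exists τ < 0 such that either I(U; P) = Σ_k u_k·τ·log₂ p_k for all n, U, P, or there exists λ ≠ 0 with I(U; P) = (1/λ)·log₂( Σ_k u_k·p_k^{τλ} ) for all n, U, P. -/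
open Set

lemma aux_cauchy (g : ℝ → ℝ) (hc : ContinuousOn g (Ici 0))
    (ha : ∀ x, 0 ≤ x → ∀ y, 0 ≤ y → g (x + y) = g x + g y) :
    ∀ x, 0 ≤ x → g x = x * g 1 := by
  have g0 : g 0 = 0 := by
    have := ha 0 le_rfl 0 le_rfl
    simp at this; exact this
  let F : ℝ →+ ℝ :=
    { toFun := fun x => g (max x 0) - g (max (-x) 0)
      map_zero' := by simp
      map_add' := by
        intro x y
        have e : max (x + y) 0 + (max (-x) 0 + max (-y) 0)
            = max (-(x + y)) 0 + (max x 0 + max y 0) := by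
          have h1 : ∀ z : ℝ, max z 0 - max (-z) 0 = z := by
            intro z
            rcases le_total z 0 with h | h
            · rw [max_eq_right h, max_eq_left (by linarith)]; ring
            · rw [max_eq_left h, max_eq_right (by linarith)]; ring
          have := h1 x; have := h1 y; have := h1 (x + y)
          linarith
        have e2 := congrArg g e
        rw [ha _ (le_max_right _ _) _ (by positivity), ha _ (le_max_right _ _) _ (le_max_right _ _),
          ha _ (le_max_right _ _) _ (by positivity), ha _ (le_max_right _ _) _ (le_max_right _ _)] at e2
        linarith }
  have Fc : Continuous F := by
    apply Continuous.sub
    · exact hc.comp_continuous (by fun_prop) (fun x => mem_Ici.2 (le_max_right _ _))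
    · exact hc.comp_continuous (by fun_prop) (fun x => mem_Ici.2 (le_max_right _ _))
  have hF : ∀ x, 0 ≤ x → F x = g x := by
    intro x hx
    change g (max x 0) - g (max (-x) 0) = g x
    rw [max_eq_left hx, max_eq_right (by linarith), g0, sub_zero]
  intro x hx
  have := map_real_smul F Fc x 1
  simp only [smul_eq_mul, mul_one] at this
  rw [← hF x hx, ← hF 1 zero_le_one, this]

lemma aux_mean (f : ℝ → ℝ) (a : ℝ) (hc : ContinuousOn f (Ici a)) (n : ℕ) (u x : Fin n → ℝ)
    (hu : IsDist u) (hx : ∀ i, a ≤ x i) : ∃ M, a ≤ M ∧ ∑ i, u i * f (x i) = f M := by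
  have h1 : Convex ℝ (f '' Ici a) :=
    (isPreconnected_Ici.image f hc).ordConnected.convex
  have h2 := h1.sum_mem (t := Finset.univ) (w := u) (z := fun i => f (x i)) (fun i _ => hu.1 i) hu.2
    (fun i _ => mem_image_of_mem f (hx i))
  obtain ⟨M, hM, e⟩ := h2
  exact ⟨M, hM, by simp only [smul_eq_mul] at e; exact e.symm⟩

lemma aux_core (h : ℝ → ℝ) (hc : ContinuousOn h (Ici 0))
    (hm : StrictMonoOn h (Ici (0:ℝ)) ∨ StrictAntiOn h (Ici (0:ℝ))) (h0 : h 0 = 0)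
    (H : ∀ S t u m : ℝ, 0 ≤ S → 0 < t → 0 ≤ u → u ≤ 1 → 0 ≤ m → u * h S = h m →
      u * h (S + t) + (1 - u) * h t = h (m + t)) :
    (∃ A : ℝ, A ≠ 0 ∧ ∀ s, 0 ≤ s → h s = A * s) ∨
    (∃ k κ : ℝ, k ≠ 0 ∧ κ ≠ 0 ∧ ∀ s, 0 ≤ s → 1 + k * h s = Real.exp (κ * s)) := by
  have inj : InjOn h (Ici 0) := by
    rcases hm with hm | hm
    · exact hm.injOn
    · exact hm.injOn
  have hne : ∀ s, 0 < s → h s ≠ 0 := by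
    intro s hs e
    have := inj (mem_Ici.2 hs.le) (mem_Ici.2 le_rfl) (e.trans h0.symm)
    exact hs.ne' this
  have ratio : ∀ m S, 0 < m → m ≤ S → 0 ≤ h m / h S ∧ h m / h S ≤ 1 := by
    intro m S hm0 hmS
    have hS : 0 < S := by linarith
    rcases hm with hm | hm
    · have a1 := hm (mem_Ici.2 le_rfl) (mem_Ici.2 hm0.le) hm0
      have a2 := hm (mem_Ici.2 le_rfl) (mem_Ici.2 hS.le) hS
      have a3 := hm.monotoneOn (mem_Ici.2 hm0.le) (mem_Ici.2 hS.le) hmS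
      rw [h0] at a1 a2
      exact ⟨by positivity, (div_le_one a2).2 a3⟩
    · have a1 := hm (mem_Ici.2 le_rfl) (mem_Ici.2 hm0.le) hm0
      have a2 := hm (mem_Ici.2 le_rfl) (mem_Ici.2 hS.le) hS
      have a3 := hm.antitoneOn (mem_Ici.2 hm0.le) (mem_Ici.2 hS.le) hmS
      rw [h0] at a1 a2
      exact ⟨div_nonneg_of_nonpos a1.le a2.le, (div_le_one_of_neg a2).2 a3⟩
  have step : ∀ m S t, 0 < m → m ≤ S → 0 < t →
      (h (m + t) - h t) * h S = h m * (h (S + t) - h t) := by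
    intro m S t hm0 hmS ht
    have hS := hne S (by linarith)
    obtain ⟨r1, r2⟩ := ratio m S hm0 hmS
    have := H S t (h m / h S) m (by linarith) ht r1 r2 hm0.le (by field_simp)
    rw [← this]
    field_simp
    ring
  have step2 : ∀ m t, 0 < m → 0 < t → (h (m + t) - h t) * h 1 = h m * (h (1 + t) - h t) := by
    intro m t hm0 ht
    rcases le_total m 1 with hl | hl
    · exact step m 1 t hm0 hl ht
    · have := step 1 m t one_pos hl ht
      linarith
  have h1 := hne 1 one_pos
  obtain ⟨k, hk⟩ : ∃ k, ∀ m t, 0 < m → 0 < t → h (m + t) = h m + h t + k * (h m * h t) := by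
    refine ⟨(h (1 + 1) - 2 * h 1) / (h 1 * h 1), fun m t hm0 ht => ?_⟩
    have e1 := step2 m t hm0 ht
    have e2 := step2 t 1 ht one_pos
    rw [add_comm t 1] at e2
    have e3 : h (m + t) = h t + h m * (h (1 + t) - h t) / h 1 := by
      field_simp; linarith
    have e4 : h (1 + t) = h 1 + h t * (h (1 + 1) - h 1) / h 1 := by
      field_simp; linarith
    rw [e3, e4]
    field_simp
    ring
  have hk' : ∀ m, 0 ≤ m → ∀ t, 0 ≤ t → h (m + t) = h m + h t + k * (h m * h t) := by
    intro m hm0 t ht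
    rcases hm0.eq_or_lt with rfl | hm0
    · simp [h0]
    rcases ht.eq_or_lt with rfl | ht
    · simp [h0]
    exact hk m t hm0 ht
  by_cases k0 : k = 0
  · left
    refine ⟨h 1, h1, fun s hs => ?_⟩
    rw [aux_cauchy h hc (by intro x hx y hy; rw [hk' x hx y hy, k0]; ring) s hs]
    ring
  · right
    have mul : ∀ x, 0 ≤ x → ∀ y, 0 ≤ y → 1 + k * h (x + y) = (1 + k * h x) * (1 + k * h y) := by
      intro x hx y hy
      rw [hk' x hx y hy]; ring
    have ne0 : ∀ x, 0 ≤ x → 1 + k * h x ≠ 0 := by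
      intro x hx e
      have e1 := mul x hx 1 zero_le_one
      rw [e, zero_mul, ← e] at e1
      have e2 : h (x + 1) = h x := by
        have : k * h (x + 1) = k * h x := by linarith
        exact mul_left_cancel₀ k0 this
      have := inj (mem_Ici.2 (by linarith)) (mem_Ici.2 hx) e2
      linarith
    have pos : ∀ x, 0 ≤ x → 0 < 1 + k * h x := by
      intro x hx
      have e := mul (x / 2) (by linarith) (x / 2) (by linarith)
      rw [add_halves] at e
      rw [e]
      exact mul_self_pos.2 (ne0 _ (by linarith))
    have L := aux_cauchy (fun x => Real.log (1 + k * h x))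
      (ContinuousOn.log (continuousOn_const.add (continuousOn_const.mul hc))
        (fun x hx => ne0 x hx))
      (by
        intro x hx y hy
        try simp only
        rw [mul x hx y hy, Real.log_mul (ne0 x hx) (ne0 y hy)])
    try simp only at L
    refine ⟨k, Real.log (1 + k * h 1), k0, ?_, ?_⟩
    · intro e
      have p1 := pos 1 zero_le_one
      have := Real.exp_log p1
      rw [e, Real.exp_zero] at this
      have : k * h 1 = 0 := by linarith
      rcases mul_eq_zero.1 this with a | a
      · exact k0 a
      · exact h1 a
    · intro s hs
      rw [mul_comm (Real.log _) s, ← L s hs, Real.exp_log (pos s hs)]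

/-- characterization of additive (e = 0) inaccuracy measures satisfying
axioms [I1]–[I3]: the Shannon/Kerridge and Rényi/Nath classes. -/
theorem additive_inaccuracy_characterization (τ : ℝ) (hτ : τ < 0)
    (f finv : ℝ → ℝ)
    (hfc : ContinuousOn f (Ici (0:ℝ)))
    (hfm : StrictMonoOn f (Ici (0:ℝ)) ∨ StrictAntiOn f (Ici (0:ℝ)))
    (hfi : ∀ x ∈ Ici (0:ℝ), finv (f x) = x)
    (EI : ℝ → ℝ)
    (hEIc : ContinuousOn EI (Ioc (0:ℝ) 1)) (hEIm : StrictAntiOn EI (Ioc (0:ℝ) 1))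
    (hEIadd : ∀ p ∈ Ioc (0:ℝ) 1, ∀ q ∈ Ioc (0:ℝ) 1, EI (p * q) = EI p + EI q)
    (hEIpos : ∀ p ∈ Ioo (0:ℝ) 1, 0 < EI p)
    (I : ∀ n : ℕ, (Fin n → ℝ) → (Fin n → ℝ) → ℝ)
    (hIdef : ∀ (n : ℕ) (U P : Fin n → ℝ),
      I n U P = finv (∑ k, U k * f (EI (P k))))
    (hadd : ∀ (n m : ℕ) (U : Fin n → ℝ) (V : Fin m → ℝ) (P : Fin n → ℝ)
      (Q : Fin m → ℝ), IsDist U → IsDist V → IsPosDist P → IsPosDist Q →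
      I (n * m) (prodDist U V) (prodDist P Q) = I n U P + I m V Q) :
    ∃ τ' : ℝ, τ' < 0 ∧
      ((∀ (n : ℕ) (U P : Fin n → ℝ), IsDist U → IsPosDist P →
        I n U P = ∑ k, U k * (τ' * Real.logb 2 (P k))) ∨
      (∃ lam : ℝ, lam ≠ 0 ∧ ∀ (n : ℕ) (U P : Fin n → ℝ), IsDist U → IsPosDist P →
        I n U P = (1 / lam) * Real.logb 2 (∑ k, U k * P k ^ (τ' * lam)))) := by
  classical
  -- EI is logarithmic
  obtain ⟨c, hc0, hEI⟩ : ∃ c : ℝ, 0 < c ∧ ∀ p, 0 < p → p ≤ 1 → EI p = -(c * Real.log p) := by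
    have hmem : ∀ s : ℝ, 0 ≤ s → Real.exp (-s) ∈ Ioc (0:ℝ) 1 := fun s hs =>
      ⟨Real.exp_pos _, Real.exp_le_one_iff.2 (by linarith)⟩
    have L := aux_cauchy (fun s => EI (Real.exp (-s)))
      (hEIc.comp (by fun_prop) (fun s hs => hmem s hs))
      (by
        intro x hx y hy
        try simp only
        rw [neg_add, Real.exp_add, hEIadd _ (hmem x hx) _ (hmem y hy)])
    try simp only at L
    refine ⟨EI (Real.exp (-1)), hEIpos _ ⟨Real.exp_pos _, Real.exp_lt_one_iff.2 (by norm_num)⟩, ?_⟩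
    intro p hp hp1
    have := L (-Real.log p) (by have := Real.log_nonpos hp.le hp1; linarith)
    rw [neg_neg, Real.exp_log hp] at this
    rw [this]; ring
  have hEInn : ∀ p, 0 < p → p ≤ 1 → 0 ≤ EI p := by
    intro p hp hp1
    rw [hEI p hp hp1]
    have := mul_nonneg hc0.le (neg_nonneg.2 (Real.log_nonpos hp.le hp1))
    linarith
  have hple : ∀ (n : ℕ) (P : Fin n → ℝ), IsPosDist P → ∀ i, P i ≤ 1 := by
    intro n P hP i
    rw [← hP.2]
    exact Finset.single_le_sum (fun j _ => (hP.1 j).le) (Finset.mem_univ i)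
  -- shift property
  have shift : ∀ (n : ℕ) (U P : Fin n → ℝ) (q : ℝ), IsDist U → IsPosDist P → 0 < q → q < 1 →
      finv (∑ k, U k * f (EI (P k) + EI q)) = finv (∑ k, U k * f (EI (P k))) + EI q := by
    intro n U P q hU hP hq0 hq1
    have h := hadd n 2 U ![1, 0] P ![q, 1 - q] hU
      ⟨by intro i; fin_cases i <;> simp, by simp⟩ hP
      ⟨by intro i; fin_cases i <;> simp [hq0, hq1], by simp⟩
    rw [hIdef, hIdef, hIdef] at h
    have e1 : ∑ k, prodDist U ![1, 0] k * f (EI (prodDist P ![q, 1 - q] k))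
        = ∑ k, U k * f (EI (P k) + EI q) := by
      unfold prodDist
      rw [Equiv.sum_comp finProdFinEquiv.symm (fun z : Fin n × Fin 2 =>
        U z.1 * (![1, 0] : Fin 2 → ℝ) z.2 * f (EI (P z.1 * (![q, 1 - q] : Fin 2 → ℝ) z.2))),
        Fintype.sum_prod_type]
      refine Finset.sum_congr rfl fun i _ => ?_
      simp only [Fin.sum_univ_two, Matrix.cons_val_zero, Matrix.cons_val_one, mul_one, mul_zero,
        zero_mul, add_zero]
      rw [hEIadd _ ⟨hP.1 i, hple n P hP i⟩ _ ⟨hq0, hq1.le⟩]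
    rw [e1] at h
    rw [h]
    congr 1
    simp only [Fin.sum_univ_two, Matrix.cons_val_zero, Matrix.cons_val_one, zero_mul, one_mul,
      add_zero]
    exact hfi _ (hEInn q hq0 hq1.le)
  have finj : InjOn f (Ici 0) := by
    rcases hfm with hm | hm
    · exact hm.injOn
    · exact hm.injOn
  set x0 := EI (1/3) with hx0
  have hx0n : 0 ≤ x0 := hEInn _ (by norm_num) (by norm_num)
  have key : ∀ x, 0 ≤ x → 0 < Real.exp (-(x / c)) ∧ Real.exp (-(x / c)) ≤ 1 ∧
      EI (Real.exp (-(x / c))) = x := by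
    intro x hx
    have hle : Real.exp (-(x / c)) ≤ 1 := by
      rw [Real.exp_le_one_iff]
      have : 0 ≤ x / c := by positivity
      linarith
    refine ⟨Real.exp_pos _, hle, ?_⟩
    rw [hEI _ (Real.exp_pos _) hle, Real.log_exp]
    field_simp
  have key3 : ∀ x, x0 ≤ x → Real.exp (-(x / c)) ≤ 1/3 := by
    intro x hx
    by_contra hlt
    push Not at hlt
    obtain ⟨k1, k2, k3⟩ := key x (by linarith)
    have := hEIm (show (1/3 : ℝ) ∈ Ioc (0:ℝ) 1 by constructor <;> norm_num) ⟨k1, k2⟩ hlt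
    rw [k3] at this
    linarith
  -- two point shift
  have shift2 : ∀ x y t u : ℝ, x0 ≤ x → x0 ≤ y → 0 < t → 0 ≤ u → u ≤ 1 →
      finv (u * f (x + t) + (1 - u) * f (y + t)) = finv (u * f x + (1 - u) * f y) + t := by
    intro x y t u hx hy ht hu hu1
    obtain ⟨a1, -, a3⟩ := key x (by linarith)
    obtain ⟨b1, -, b3⟩ := key y (by linarith)
    obtain ⟨c1, c2, c3⟩ := key t ht.le
    have a4 := key3 x hx
    have b4 := key3 y hy
    have c4 : Real.exp (-(t / c)) < 1 := by
      rw [Real.exp_lt_one_iff]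
      have : 0 < t / c := by positivity
      linarith
    have h := shift 3 ![u, 1 - u, 0]
      ![Real.exp (-(x / c)), Real.exp (-(y / c)), 1 - Real.exp (-(x / c)) - Real.exp (-(y / c))]
      (Real.exp (-(t / c)))
      ⟨by intro i; fin_cases i <;> simp [hu, hu1], by simp [Fin.sum_univ_three]⟩
      ⟨by
        intro i
        fin_cases i
        · exact a1
        · exact b1
        · show 0 < 1 - Real.exp (-(x / c)) - Real.exp (-(y / c))
          linarith, by simp [Fin.sum_univ_three]⟩ c1 c4
    simpa [Fin.sum_univ_three, a3, b3, c3] using h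
  -- functional equation for the shifted function
  have core := aux_core (fun s => f (x0 + s) - f x0)
    ((hfc.comp (by fun_prop) (fun s (hs : 0 ≤ s) => mem_Ici.2 (by linarith))).sub
      continuousOn_const)
    (by
      rcases hfm with hm | hm
      · left
        intro a (ha : 0 ≤ a) b (hb : 0 ≤ b) hab
        have := hm (mem_Ici.2 (show 0 ≤ x0 + a by linarith))
          (mem_Ici.2 (show 0 ≤ x0 + b by linarith)) (by linarith)
        simp only; linarith
      · right
        intro a (ha : 0 ≤ a) b (hb : 0 ≤ b) hab
        have := hm (mem_Ici.2 (show 0 ≤ x0 + a by linarith))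
          (mem_Ici.2 (show 0 ≤ x0 + b by linarith)) (by linarith)
        simp only; linarith)
    (by simp)
    (by
      intro S t u m hS ht hu hu1 hm e
      try simp only at e ⊢
      have s2 := shift2 (x0 + S) x0 t u (by linarith) le_rfl ht hu hu1
      have e1 : u * f (x0 + S) + (1 - u) * f x0 = f (x0 + m) := by linarith
      rw [e1, hfi _ (mem_Ici.2 (by linarith))] at s2
      obtain ⟨M, hM, eM⟩ := aux_mean f 0 hfc 2 ![u, 1 - u] ![x0 + S + t, x0 + t]
        ⟨by intro i; fin_cases i <;> simp [hu, hu1], by simp⟩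
        (by
          intro i
          fin_cases i
          · show 0 ≤ x0 + S + t
            linarith
          · show 0 ≤ x0 + t
            linarith)
      simp only [Fin.sum_univ_two, Matrix.cons_val_zero, Matrix.cons_val_one] at eM
      rw [eM, hfi _ (mem_Ici.2 hM)] at s2
      rw [s2] at eM
      rw [← add_assoc, ← add_assoc, ← eM]
      ring)
  -- the values of I
  have value : ∀ (n : ℕ) (U P : Fin n → ℝ), IsDist U → IsPosDist P →
      0 ≤ I n U P ∧ ∑ k, U k * (f (x0 + EI (P k)) - f x0) = f (x0 + I n U P) - f x0 := by
    intro n U P hU hP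
    have h := shift n U P (1/3) hU hP (by norm_num) (by norm_num)
    rw [← hIdef, ← hx0] at h
    obtain ⟨M, hM, eM⟩ := aux_mean f x0 (hfc.mono (Ici_subset_Ici.2 hx0n)) n U
      (fun k => EI (P k) + x0) hU
      (fun i => by have := hEInn _ (hP.1 i) (hple n P hP i); linarith)
    try simp only at eM
    rw [eM, hfi _ (mem_Ici.2 (by linarith))] at h
    refine ⟨by linarith, ?_⟩
    have : x0 + I n U P = M := by linarith
    rw [this, ← eM]
    simp only [mul_sub, Finset.sum_sub_distrib, ← Finset.sum_mul, hU.2, one_mul, add_comm x0]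
  have hl2 : 0 < Real.log 2 := Real.log_pos (by norm_num)
  refine ⟨-(c * Real.log 2), by have := mul_pos hc0 hl2; linarith, ?_⟩
  rcases core with ⟨A, hA, hlin⟩ | ⟨k, κ, hk, hκ, hexp⟩
  · left
    intro n U P hU hP
    obtain ⟨v1, v2⟩ := value n U P hU hP
    try simp only at hlin
    rw [hlin _ v1] at v2
    apply mul_left_cancel₀ hA
    rw [← v2, Finset.mul_sum]
    refine Finset.sum_congr rfl fun i _ => ?_
    rw [hlin _ (hEInn _ (hP.1 i) (hple n P hP i)), hEI _ (hP.1 i) (hple n P hP i), Real.logb]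
    field_simp
  · right
    refine ⟨κ / Real.log 2, by positivity, ?_⟩
    intro n U P hU hP
    obtain ⟨v1, v2⟩ := value n U P hU hP
    try simp only at hexp
    have e : ∑ i, U i * P i ^ (-(c * Real.log 2) * (κ / Real.log 2))
        = Real.exp (κ * I n U P) := by
      rw [← hexp _ v1, ← v2, Finset.mul_sum]
      nth_rewrite 1 [← hU.2]
      rw [← Finset.sum_add_distrib]
      refine Finset.sum_congr rfl fun i _ => ?_
      have h3 := hexp _ (hEInn _ (hP.1 i) (hple n P hP i))
      have h4 : P i ^ (-(c * Real.log 2) * (κ / Real.log 2)) = Real.exp (κ * EI (P i)) := by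
        rw [Real.rpow_def_of_pos (hP.1 i), hEI _ (hP.1 i) (hple n P hP i)]
        congr 1
        field_simp
      rw [h4, ← h3]
      ring
    rw [e, Real.logb, Real.log_exp]
    field_simp
end

section
/- Let n, m ≥ 1, λ ≠ 0, e ≠ 0, c, τ ∈ ℝ, and for W ∈ Δ_r, R ∈ Δ_r⁺ define I(W; R) = (1/e)·( ( Σ_{k=1}^r w_k·r_k^{τλ} )^{c/λ} − 1 ). Then for all U ∈ Δ_n, V ∈ Δ_m, P ∈ Δ_n⁺, Q ∈ Δ_m⁺: I(U⋆V; P⋆Q) = I(U; P) + I(V; Q) + e·I(U; P)·I(V; Q). -/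
open Set

/-- The Sharma–Mittal/Tsallis-type inaccuracy measure `I^{c,e}_{τ,λ}`. -/
noncomputable def ImeasSM (e c τ lam : ℝ) {r : ℕ} (W R : Fin r → ℝ) : ℝ :=
  (1 / e) * ((∑ k, W k * R k ^ (τ * lam)) ^ (c / lam) - 1)

/-- pseudo-additivity (axiom [I3]) of the Sharma–Mittal/Tsallis-type
inaccuracy measure `I^{c,e}_{τ,λ}`. -/
theorem sharma_mittal_pseudo_additive (n m : ℕ) (hn : 1 ≤ n) (hm : 1 ≤ m)
    (lam e c τ : ℝ) (hlam : lam ≠ 0) (he : e ≠ 0)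
    (U : Fin n → ℝ) (V : Fin m → ℝ) (P : Fin n → ℝ) (Q : Fin m → ℝ)
    (hU : IsDist U) (hV : IsDist V) (hP : IsPosDist P) (hQ : IsPosDist Q) :
    ImeasSM e c τ lam (prodDist U V) (prodDist P Q) =
      ImeasSM e c τ lam U P + ImeasSM e c τ lam V Q +
        e * ImeasSM e c τ lam U P * ImeasSM e c τ lam V Q := by
  have hsum : ∑ k, prodDist U V k * prodDist P Q k ^ (τ * lam) =
      (∑ k, U k * P k ^ (τ * lam)) * (∑ k, V k * Q k ^ (τ * lam)) := by
    rw [Finset.sum_mul_sum, ← Fintype.sum_prod_type', ← finProdFinEquiv.symm.sum_comp]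
    refine Finset.sum_congr rfl fun i _ => ?_
    simp only [prodDist]
    rw [Real.mul_rpow (hP.1 _).le (hQ.1 _).le]
    ring
  have h1 : 0 ≤ ∑ k, U k * P k ^ (τ * lam) :=
    Finset.sum_nonneg fun i _ => mul_nonneg (hU.1 i) (Real.rpow_nonneg (hP.1 i).le _)
  have h2 : 0 ≤ ∑ k, V k * Q k ^ (τ * lam) :=
    Finset.sum_nonneg fun i _ => mul_nonneg (hV.1 i) (Real.rpow_nonneg (hQ.1 i).le _)
  unfold ImeasSM
  rw [hsum, Real.mul_rpow h1 h2]
  field_simp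
  ring
end

section
/- Let n, m ≥ 1, λ ≠ 0, e ≠ 0, c, τ ∈ ℝ, and for W ∈ Δ_r, R ∈ Δ_r⁺ define C(W; R) = (1/e)·( Σ_{k=1}^r w_k·r_k^{τλ} )^{−c/λ}. Then for all U ∈ Δ_n, V ∈ Δ_m, P ∈ Δ_n⁺, Q ∈ Δ_m⁺: C(U⋆V; P⋆Q) = e·C(U; P)·C(V; Q). -/
open Set

/-- The generalized certainty measure `C_{τ,λ}` of equation (31) of the paper. -/
noncomputable def CmeasGen (e c τ lam : ℝ) {r : ℕ} (W R : Fin r → ℝ) : ℝ :=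
  (1 / e) * (∑ k, W k * R k ^ (τ * lam)) ^ (-(c / lam))

/-- multiplicativity (axiom [C3]) of the generalized certainty
measure `C_{τ,λ}`. -/
theorem certainty_measure_multiplicative (n m : ℕ) (hn : 1 ≤ n) (hm : 1 ≤ m)
    (lam e c τ : ℝ) (hlam : lam ≠ 0) (he : e ≠ 0)
    (U : Fin n → ℝ) (V : Fin m → ℝ) (P : Fin n → ℝ) (Q : Fin m → ℝ)
    (hU : IsDist U) (hV : IsDist V) (hP : IsPosDist P) (hQ : IsPosDist Q) :
    CmeasGen e c τ lam (prodDist U V) (prodDist P Q) =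
      e * CmeasGen e c τ lam U P * CmeasGen e c τ lam V Q := by
  have key : ∑ k, prodDist U V k * prodDist P Q k ^ (τ * lam) =
      (∑ k, U k * P k ^ (τ * lam)) * (∑ k, V k * Q k ^ (τ * lam)) := by
    rw [Finset.sum_mul_sum, ← Fintype.sum_prod_type', ← finProdFinEquiv.symm.sum_comp]
    refine Finset.sum_congr rfl fun i _ => ?_
    simp only [prodDist]
    rw [Real.mul_rpow (hP.1 _).le (hQ.1 _).le]
    ring
  have h1 : 0 ≤ ∑ k, U k * P k ^ (τ * lam) :=
    Finset.sum_nonneg fun i _ => mul_nonneg (hU.1 i) (Real.rpow_nonneg (hP.1 i).le _)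
  have h2 : 0 ≤ ∑ k, V k * Q k ^ (τ * lam) :=
    Finset.sum_nonneg fun i _ => mul_nonneg (hV.1 i) (Real.rpow_nonneg (hQ.1 i).le _)
  unfold CmeasGen
  rw [key, Real.mul_rpow h1 h2]
  field_simp
end
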